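/- arXiv:1501.05021 — 2 statements merged into one kernel-verified Lean document; each statement's English description precedes it below -/
import Mathlib

section
/- There exist absolute constants C₀ and ε > 0 such that the following holds. For any constants a > b > C₀ and ε > γ > 0 satisfying (a-b)²/(a+b) ≥ 8.1 · log(2/γ), there exists an estimator (a function assigning to each graph on V a pair of disjoint subsets partitioning V) which, applied to a graph drawn from the two-block stochastic block model SBM(n,a,b), outputs a γ-correct partition with probability 1 − o(1) as n → ∞. -/
open MeasureTheory Filter Finset

/-- The Bernoulli measure on `Bool` with success probability `p` (clamped to `[0,1]`). -/
noncomputable def bern (p : ℝ) : Measure Bool :=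
  (PMF.bernoulli (min (Real.toNNReal p) 1) (min_le_right _ _)).toMeasure

instance (p : ℝ) : IsProbabilityMeasure (bern p) := by
  unfold bern; infer_instance

/-- Index set for the unordered pairs of distinct vertices of `Fin N`. -/
abbrev EdgeIdx (N : ℕ) := {e : Fin N × Fin N // e.1 < e.2}

/-- A configuration of edges: which unordered pairs form an edge. -/
abbrev Config (N : ℕ) := EdgeIdx N → Bool

/-- A colored configuration: for every pair, (edge present, edge Red). For the censor
block model the second component is instead the noise bit of the pair. -/
abbrev CConfig (N : ℕ) := EdgeIdx N → Bool × Bool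

/-- Adjacency relation of the graph determined by a configuration. -/
def adjOf {N : ℕ} (ω : Config N) (i j : Fin N) : Bool :=
  if h : i < j then ω ⟨(i, j), h⟩ else if h : j < i then ω ⟨(j, i), h⟩ else false

/-- Degree of a vertex in the graph determined by a configuration. -/
def degOf {N : ℕ} (ω : Config N) (v : Fin N) : ℕ :=
  (univ.filter fun j => adjOf ω v j).card

/-- The two-block stochastic block model `SBM(n,a,b)` on `2*n` vertices: within-block
pairs are edges with probability `a/n`, cross-block pairs with probability `b/n`,
independently. -/
noncomputable def sbm2 (n : ℕ) (a b : ℝ) : Measure (Config (2 * n)) :=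
  Measure.pi fun e =>
    bern (if ((e.1.1 : ℕ) < n ↔ (e.1.2 : ℕ) < n) then a / n else b / n)

/-- The first block `V₁` (the first `n` vertices). -/
def block1 (n : ℕ) : Finset (Fin (2 * n)) := univ.filter fun i => (i : ℕ) < n

/-- The second block `V₂` (the last `n` vertices). -/
def block2 (n : ℕ) : Finset (Fin (2 * n)) := univ.filter fun i => ¬ (i : ℕ) < n

/-- `(V₁', V₂')` is `γ`-correct: `|Vᵢ ∩ Vᵢ'| ≥ (1-γ)n` for `i = 1,2`. -/
def correct2 (n : ℕ) (γ : ℝ) (P : Finset (Fin (2 * n)) × Finset (Fin (2 * n))) : Prop :=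
  (1 - γ) * (n : ℝ) ≤ ((block1 n ∩ P.1).card : ℝ) ∧
  (1 - γ) * (n : ℝ) ≤ ((block2 n ∩ P.2).card : ℝ)

/-- A pair of disjoint subsets partitioning the vertex set. -/
def isPartition2 {N : ℕ} (P : Finset (Fin N) × Finset (Fin N)) : Prop :=
  Disjoint P.1 P.2 ∧ P.1 ∪ P.2 = univ

/-- Expected adjacency matrix of `SBM(n,a,b)`. -/
noncomputable def expAdj (n : ℕ) (a b : ℝ) : Matrix (Fin (2 * n)) (Fin (2 * n)) ℝ :=
  fun i j => if i = j then 0 else if ((i : ℕ) < n ↔ (j : ℕ) < n) then a / n else b / n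

/-- Adjacency matrix (over `ℝ`) of the graph determined by a configuration. -/
noncomputable def adjMat {N : ℕ} (ω : Config N) : Matrix (Fin N) (Fin N) ℝ :=
  fun i j => if adjOf ω i j then 1 else 0

/-- Zero out all rows and columns corresponding to vertices of degree `> 20 d`. -/
noncomputable def zeroOutHighDeg {N : ℕ} (d : ℝ) (ω : Config N)
    (M : Matrix (Fin N) (Fin N) ℝ) : Matrix (Fin N) (Fin N) ℝ :=
  fun i j => if 20 * d < (degOf ω i : ℝ) ∨ 20 * d < (degOf ω j : ℝ) then 0 else M i j

/-- The spectral (ℓ² operator) norm of a real square matrix. -/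
noncomputable def opNorm {N : ℕ} (M : Matrix (Fin N) (Fin N) ℝ) : ℝ :=
  ‖LinearMap.toContinuousLinearMap (Matrix.toEuclideanLin M)‖

/-- The orthogonal projection onto a subspace, as an endomorphism. -/
noncomputable def projCLM {N : ℕ} (W : Submodule ℝ (EuclideanSpace ℝ (Fin N))) :
    EuclideanSpace ℝ (Fin N) →L[ℝ] EuclideanSpace ℝ (Fin N) :=
  W.subtypeL.comp (Submodule.orthogonalProjectionOnto W)

/-- `sin ∠(W₁, W₂) := ‖P_{W₁} - P_{W₂}‖`. -/
noncomputable def sinAngle {N : ℕ} (W₁ W₂ : Submodule ℝ (EuclideanSpace ℝ (Fin N))) : ℝ :=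
  ‖projCLM W₁ - projCLM W₂‖

/-- Build a vector of `EuclideanSpace ℝ (Fin N)` from its coordinates. -/
noncomputable def mkVec {N : ℕ} (f : Fin N → ℝ) : EuclideanSpace ℝ (Fin N) :=
  (EuclideanSpace.equiv (Fin N) ℝ).symm f

/-- `W` is the eigenspace corresponding to the top two eigenvalues of the symmetric
matrix `M`: it is spanned by two orthonormal eigenvectors whose eigenvalues dominate
every eigenvalue attained on `Wᗮ`. -/
def IsTopTwoSpace {N : ℕ} (M : Matrix (Fin N) (Fin N) ℝ)
    (W : Submodule ℝ (EuclideanSpace ℝ (Fin N))) : Prop :=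
  ∃ (u₁ u₂ : EuclideanSpace ℝ (Fin N)) (μ₁ μ₂ : ℝ),
    (inner ℝ u₁ u₂ : ℝ) = 0 ∧ ‖u₁‖ = 1 ∧ ‖u₂‖ = 1 ∧
    W = Submodule.span ℝ {u₁, u₂} ∧
    Matrix.toEuclideanLin M u₁ = μ₁ • u₁ ∧
    Matrix.toEuclideanLin M u₂ = μ₂ • u₂ ∧
    ∀ (μ : ℝ) (v : EuclideanSpace ℝ (Fin N)), v ≠ 0 → v ∈ Wᗮ →
      Matrix.toEuclideanLin M v = μ • v → μ ≤ min μ₁ μ₂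

/-- `P` is a possible output of the **Spectral Partition** algorithm run on the
configuration `ω` with degree parameter `d`. -/
def IsSpectralOutput (n : ℕ) (ω : Config (2 * n)) (d : ℝ)
    (P : Finset (Fin (2 * n)) × Finset (Fin (2 * n))) : Prop :=
  ∃ (W : Submodule ℝ (EuclideanSpace ℝ (Fin (2 * n))))
    (v : EuclideanSpace ℝ (Fin (2 * n))),
    IsTopTwoSpace (zeroOutHighDeg d ω (adjMat ω)) W ∧
    v ∈ W ∧ ‖v‖ = 1 ∧ (inner ℝ (projCLM W (mkVec fun _ => 1)) v : ℝ) = 0 ∧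
    P.1.card = n ∧ P.2 = P.1ᶜ ∧ ∀ i ∈ P.1, ∀ j ∈ P.2, v j ≤ v i

/-- The two-block SBM together with an independent fair Red/Blue coloring of each edge:
first component = edge present, second component = edge colored Red. -/
noncomputable def sbm2c (n : ℕ) (a b : ℝ) : Measure (CConfig (2 * n)) :=
  Measure.pi fun e =>
    (bern (if ((e.1.1 : ℕ) < n ↔ (e.1.2 : ℕ) < n) then a / n else b / n)).prod
      (bern (1 / 2))

/-- The Red subgraph of a colored configuration. -/
def redConf {N : ℕ} (ω : CConfig N) : Config N := fun e => (ω e).1 && (ω e).2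

/-- The Blue subgraph of a colored configuration. -/
def blueConf {N : ℕ} (ω : CConfig N) : Config N := fun e => (ω e).1 && !(ω e).2

/-- Number of Blue neighbors of `u` inside `S`. -/
noncomputable def blueDegIn {N : ℕ} (ω : CConfig N) (S : Finset (Fin N)) (u : Fin N) : ℕ :=
  (S.filter fun v => adjOf (blueConf ω) u v).card

/-- Number of Red neighbors of `u` inside `S`. -/
noncomputable def redDegIn {N : ℕ} (ω : CConfig N) (S : Finset (Fin N)) (u : Fin N) : ℕ :=
  (S.filter fun v => adjOf (redConf ω) u v).card

/-- The **Correction** subroutine with threshold `t`: a vertex of `P.i` is bad if it has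
at least `t` Blue neighbors in the other class; bad vertices are moved to the other side. -/
noncomputable def corrected2 {N : ℕ} (t : ℝ) (ω : CConfig N)
    (P : Finset (Fin N) × Finset (Fin N)) : Finset (Fin N) × Finset (Fin N) :=
  let bad1 := P.1.filter fun u => t ≤ (blueDegIn ω P.2 u : ℝ)
  let bad2 := P.2.filter fun u => t ≤ (blueDegIn ω P.1 u : ℝ)
  ((P.1 \ bad1) ∪ bad2, (P.2 \ bad2) ∪ bad1)

/-- The `k`-block SBM on `k*m` vertices (`k` blocks of size `m`, so `n = k*m` total
vertices and edge probabilities `a/n` within blocks and `b/n` across). -/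
noncomputable def sbmK (k m : ℕ) (a b : ℝ) : Measure (Config (k * m)) :=
  Measure.pi fun e =>
    bern (if (e.1.1 : ℕ) / m = (e.1.2 : ℕ) / m then a / (k * m) else b / (k * m))

/-- The `i`-th block `Vᵢ` (of size `m = n/k`). -/
def blockK (k m : ℕ) (i : Fin k) : Finset (Fin (k * m)) :=
  univ.filter fun v => (v : ℕ) / m = (i : ℕ)

/-- The subset `Z` selected by the splitting coins `s` (its complement is `Y`). -/
def Zset {N : ℕ} (s : Fin N → Bool) : Finset (Fin N) := univ.filter fun v => s v = true

/-- The `k`-block SBM together with a uniformly random split of the vertices. -/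
noncomputable def sbmKs (k m : ℕ) (a b : ℝ) :
    Measure ((Fin (k * m) → Bool) × Config (k * m)) :=
  (Measure.pi fun _ : Fin (k * m) => bern (1 / 2)).prod (sbmK k m a b)

/-- The `k`-block SBM together with a uniformly random split of the vertices and an
independent fair Red/Blue coloring of each edge. -/
noncomputable def sbmKsc (k m : ℕ) (a b : ℝ) :
    Measure ((Fin (k * m) → Bool) × CConfig (k * m)) :=
  (Measure.pi fun _ : Fin (k * m) => bern (1 / 2)).prod
    (Measure.pi fun e : EdgeIdx (k * m) =>
      (bern (if (e.1.1 : ℕ) / m = (e.1.2 : ℕ) / m then a / (k * m) else b / (k * m))).prod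
        (bern (1 / 2)))

/-- `U` is a `γ`-correct partition of `Z = (V₁ ∩ Z) ∪ ... ∪ (V_k ∩ Z)`:
a collection of disjoint subsets of `Z` covering `Z` with
`|(Vᵢ ∩ Z) ∩ Uᵢ| ≥ (1-γ)|Vᵢ ∩ Z|` for every `i`. -/
def correctOnZ (k m : ℕ) (γ : ℝ) (s : Fin (k * m) → Bool)
    (U : Fin k → Finset (Fin (k * m))) : Prop :=
  (∀ i, U i ⊆ Zset s) ∧ (∀ i j, i ≠ j → Disjoint (U i) (U j)) ∧
  (univ.biUnion U = Zset s) ∧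
  ∀ i, (1 - γ) * ((blockK k m i ∩ Zset s).card : ℝ) ≤
    (((blockK k m i ∩ Zset s) ∩ U i).card : ℝ)

/-- Censor block model: for every pair of vertices, an independent pair
(edge present with probability `p`, noise bit with probability `ε`). -/
noncomputable def cbmMeasure (n : ℕ) (p ε : ℝ) : Measure (CConfig (2 * n)) :=
  Measure.pi fun _ => (bern p).prod (bern ε)

/-- The observation `y = B_G x ⊕ z` of the censor block model: for each present edge
`(i,j)` one observes `x_i ⊕ x_j ⊕ z_e` (where `x` is the indicator of the second
block); nothing is observed on absent edges. -/
def cbmObs (n : ℕ) (ω : CConfig (2 * n)) (e : EdgeIdx (2 * n)) : Option Bool :=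
  if (ω e).1 then
    some (xor (xor (decide ((e.1.1 : ℕ) < n)) (decide ((e.1.2 : ℕ) < n))) (ω e).2)
  else none

/-- `e(S,T)`: adjacency-matrix count of edges between `S` and `T` in a simple graph. -/
def eCount {n : ℕ} (G : SimpleGraph (Fin n)) [DecidableRel G.Adj]
    (S T : Finset (Fin n)) : ℝ :=
  ∑ i ∈ S, ∑ j ∈ T, if G.Adj i j then 1 else 0

/-- `e(S,T)` for the graph of a configuration. -/
def eCountC {n : ℕ} (ω : Config n) (S T : Finset (Fin n)) : ℝ :=
  ∑ i ∈ S, ∑ j ∈ T, if adjOf ω i j then 1 else 0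

/-- The random symmetric matrix model: independent edges, pair `(i,j)` present with
probability `p i j`. -/
noncomputable def genMeasure {n : ℕ} (p : Fin n → Fin n → ℝ) : Measure (Config n) :=
  Measure.pi fun e => bern (p e.1.1 e.1.2)

/-- The centered matrix `M` with `M_ij = 1 - p_ij` if the pair is present and
`M_ij = -p_ij` otherwise, and zero diagonal. -/
noncomputable def centeredMat {n : ℕ} (p : Fin n → Fin n → ℝ) (ω : Config n) :
    Matrix (Fin n) (Fin n) ℝ :=
  fun i j => if i = j then 0 else (if adjOf ω i j then 1 else 0) - p i j

/-- Number of positive entries in row `i` of `M`. -/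
noncomputable def posRowCount {n : ℕ} (M : Matrix (Fin n) (Fin n) ℝ) (i : Fin n) : ℕ :=
  (univ.filter fun j => 0 < M i j).card

/-- Zero out the rows and columns indexed by `S`. -/
noncomputable def zeroOutRows {n : ℕ} (S : Finset (Fin n)) (M : Matrix (Fin n) (Fin n) ℝ) :
    Matrix (Fin n) (Fin n) ℝ :=
  fun i j => if i ∈ S ∨ j ∈ S then 0 else M i j

/-- The all-ones direction `v̄₁` (unit vector). -/
noncomputable def vbar1 (n : ℕ) : EuclideanSpace ℝ (Fin (2 * n)) :=
  mkVec fun _ => 1 / Real.sqrt (2 * n)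

/-- The block-indicator direction `v̄₂` (unit vector). -/
noncomputable def vbar2 (n : ℕ) : EuclideanSpace ℝ (Fin (2 * n)) :=
  mkVec fun i =>
    if (i : ℕ) < n then 1 / Real.sqrt (2 * n) else -(1 / Real.sqrt (2 * n))

/-- The pair `e` is separated by the vertex set `S`. -/
def Separates {N : ℕ} (S : Finset (Fin N)) (e : EdgeIdx N) : Prop :=
  ¬ (e.1.1 ∈ S ↔ e.1.2 ∈ S)

instance {N : ℕ} (S : Finset (Fin N)) : DecidablePred (Separates S) := fun e => by
  unfold Separates; infer_instance

/-- Number of edges of the configuration between `S` and its complement. -/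
def cutSize {N : ℕ} (ω : Config N) (S : Finset (Fin N)) : ℕ :=
  (univ.filter fun e => ω e = true ∧ Separates S e).card

/-- The `±1`-valued indicator of `S`. -/
def signOf {N : ℕ} (S : Finset (Fin N)) (i : Fin N) : ℝ := if i ∈ S then 1 else -1

lemma integral_bern {p : ℝ} (h0 : 0 ≤ p) (h1 : p ≤ 1) (f : Bool → ℝ) :
    ∫ x, f x ∂(bern p) = p * f true + (1 - p) * f false := by
  have h1' : p.toNNReal ≤ 1 := by simpa using h1
  unfold bern
  rw [PMF.integral_eq_sum]
  simp [PMF.bernoulli, h1', h0]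

lemma prod_cut_weights {N : ℕ} (ω : Config N) (S A : Finset (Fin N)) (t : ℝ) :
    ∏ e, (if ω e = true then
      (if Separates A e then t else 1) * (if Separates S e then t⁻¹ else 1) else 1) =
      t ^ cutSize ω A / t ^ cutSize ω S := by
  have key : ∀ (B : Finset (Fin N)) (c : ℝ),
      ∏ e, (if ω e = true then (if Separates B e then c else 1) else 1) = c ^ cutSize ω B := by
    intro B c
    simp_rw [← ite_and]
    rw [Finset.prod_ite]
    simp [cutSize]
  rw [div_eq_mul_inv, ← inv_pow, ← key A, ← key S, ← Finset.prod_mul_distrib]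
  refine Finset.prod_congr rfl fun e _ => ?_
  split_ifs <;> simp

lemma mem_block1 {n : ℕ} (i : Fin (2 * n)) : i ∈ block1 n ↔ (i : ℕ) < n := by
  simp [block1]

lemma prob_cut_le_exp_sum {n : ℕ} {a b t : ℝ} (ha : 0 < a) (hb : 0 < b) (han : a ≤ n)
    (hbn : b ≤ n) (ht : 1 ≤ t) (S : Finset (Fin (2 * n))) :
    (sbm2 n a b).real {ω | cutSize ω S ≤ cutSize ω (block1 n)} ≤
      Real.exp (∑ e : EdgeIdx (2 * n), if Separates (block1 n) e
        then (if Separates S e then 0 else b * (t - 1) / n)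
        else (if Separates S e then a * (t⁻¹ - 1) / n else 0)) := by
  have ht0 : 0 < t := by linarith
  have hn : (0 : ℝ) < n := by linarith
  let f : EdgeIdx (2 * n) → Bool → ℝ := fun e x => if x = true then
      (if Separates (block1 n) e then t else 1) * (if Separates S e then t⁻¹ else 1) else 1
  have hf : ∀ ω : Config (2 * n), ∏ e, f e (ω e) =
      t ^ cutSize ω (block1 n) / t ^ cutSize ω S := fun ω => prod_cut_weights ω S _ t
  have : IsProbabilityMeasure (sbm2 n a b) := by unfold sbm2; infer_instance
  have markov := mul_meas_ge_le_integral_of_nonneg (μ := sbm2 n a b)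
    (f := fun ω => ∏ e, f e (ω e))
    (Eventually.of_forall fun ω => by simp only [hf]; positivity) Integrable.of_finite 1
  rw [one_mul] at markov
  have hsub : {ω | cutSize ω S ≤ cutSize ω (block1 n)} ⊆
      {ω : Config (2 * n) | 1 ≤ ∏ e, f e (ω e)} := by
    intro ω hω
    simp only [Set.mem_ofPred_eq, hf] at hω ⊢
    rw [one_le_div (by positivity)]
    exact pow_le_pow_right₀ ht hω
  refine (measureReal_mono hsub).trans (markov.trans ?_)
  have hint : ∫ ω, ∏ e, f e (ω e) ∂(sbm2 n a b) = ∏ e : EdgeIdx (2 * n), ∫ x, f e x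
      ∂(bern (if ((e.1.1 : ℕ) < n ↔ (e.1.2 : ℕ) < n) then a / n else b / n)) :=
    integral_fintype_prod_eq_prod f
  rw [hint, Real.exp_sum]
  have hpa : 0 ≤ a / n := by positivity
  have hpb : 0 ≤ b / n := by positivity
  have hpa1 : a / n ≤ 1 := by rwa [div_le_one hn]
  have hpb1 : b / n ≤ 1 := by rwa [div_le_one hn]
  have hnn : ∀ e x, 0 ≤ f e x := by
    intro e x; simp only [f]; split_ifs <;> positivity
  refine Finset.prod_le_prod (fun e _ => integral_nonneg (hnn e)) fun e _ => ?_
  have hsep : Separates (block1 n) e ↔ ¬ ((e.1.1 : ℕ) < n ↔ (e.1.2 : ℕ) < n) := by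
    simp only [Separates, mem_block1]
  by_cases hA : ((e.1.1 : ℕ) < n ↔ (e.1.2 : ℕ) < n)
  · rw [if_pos hA, integral_bern hpa hpa1]
    have hA' : ¬ Separates (block1 n) e := by simpa [hsep] using hA
    simp only [f, hA', if_false, if_true, one_mul, Bool.false_eq_true]
    split_ifs
    · have := Real.add_one_le_exp (a * (t⁻¹ - 1) / n)
      calc _ = a * (t⁻¹ - 1) / n + 1 := by ring
        _ ≤ _ := this
    · simp
  · rw [if_neg hA, integral_bern hpb hpb1]
    have hA' : Separates (block1 n) e := hsep.2 hA
    simp only [f, hA', if_true, Bool.false_eq_true, if_false]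
    split_ifs
    · simp [ht0.ne']
    · have := Real.add_one_le_exp (b * (t - 1) / n)
      calc _ = b * (t - 1) / n + 1 := by ring
        _ ≤ _ := this

lemma two_mul_sum_edgeIdx {N : ℕ} (F : Fin N → Fin N → ℝ) (hsymm : ∀ i j, F i j = F j i)
    (hdiag : ∀ i, F i i = 0) :
    2 * ∑ e : EdgeIdx N, F e.1.1 e.1.2 = ∑ i, ∑ j, F i j := by
  have h1 : ∑ e : EdgeIdx N, F e.1.1 e.1.2 =
      ∑ i, ∑ j, if i < j then F i j else 0 := by
    rw [← Fintype.sum_prod_type' (f := fun i j => if i < j then F i j else 0),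
      ← Finset.sum_filter]
    exact (Finset.sum_subtype _ (by simp) (fun e : Fin N × Fin N => F e.1 e.2)).symm
  have h2 : ∑ i, ∑ j, (if i < j then F i j else 0) =
      ∑ i, ∑ j, if j < i then F i j else 0 := by
    rw [Finset.sum_comm]
    simp_rw [fun i j => hsymm i j]
  rw [two_mul, h1]
  nth_rewrite 2 [h2]
  simp_rw [← Finset.sum_add_distrib]
  refine Finset.sum_congr rfl fun i _ => Finset.sum_congr rfl fun j _ => ?_
  rcases lt_trichotomy i j with h | rfl | h
  · simp [h, h.not_gt]
  · simp [hdiag]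
  · simp [h, h.not_gt]

lemma card_block1 (n : ℕ) : (block1 n).card = n := by
  have : block1 n = univ.filter fun i : Fin (2 * n) => (i : ℕ) < n := rfl
  rw [this, Fin.card_filter_val_lt]; omega

lemma sum_signOf {N : ℕ} (S : Finset (Fin N)) : ∑ i, signOf S i = 2 * S.card - N := by
  have : ∀ i, signOf S i = 2 * (if i ∈ S then (1 : ℝ) else 0) - 1 := by
    intro i; unfold signOf; split_ifs <;> norm_num
  simp_rw [this, Finset.sum_sub_distrib, ← Finset.mul_sum]
  simp

lemma sum_signOf_mul {N : ℕ} (S A : Finset (Fin N)) :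
    ∑ i, signOf A i * signOf S i = N - 2 * (A \ S).card - 2 * (S \ A).card := by
  have : ∀ i, signOf A i * signOf S i =
      1 - 2 * (if i ∈ A \ S then (1 : ℝ) else 0) - 2 * (if i ∈ S \ A then 1 else 0) := by
    intro i; unfold signOf
    by_cases h1 : i ∈ A <;> by_cases h2 : i ∈ S <;> simp [h1, h2] <;> norm_num
  simp_rw [this, Finset.sum_sub_distrib, ← Finset.mul_sum, Finset.sum_boole,
    Finset.filter_univ_mem]
  simp

lemma sum_separation_weights {n : ℕ} {A S : Finset (Fin (2 * n))} (hA : A.card = n)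
    (hS : S.card = n) (c d : ℝ) :
    ∑ e : EdgeIdx (2 * n), (if Separates A e
        then (if Separates S e then 0 else c)
        else (if Separates S e then d else 0)) =
      (c + d) * (2 * (A \ S).card * (n - (A \ S).card)) := by
  set m : ℝ := ((A \ S).card : ℝ) with hm
  have hm' : ((S \ A).card : ℝ) = m := by
    rw [hm, Finset.card_sdiff_comm (hS.trans hA.symm)]
  let σ := signOf A
  let τ := signOf S
  let F : Fin (2 * n) → Fin (2 * n) → ℝ := fun i j =>
    (c * ((1 - σ i * σ j) * (1 + τ i * τ j)) + d * ((1 + σ i * σ j) * (1 - τ i * τ j))) / 4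
  have hsq : ∀ (B : Finset (Fin (2 * n))) i, signOf B i * signOf B i = 1 := by
    intro B i; unfold signOf; split_ifs <;> norm_num
  have hsum := two_mul_sum_edgeIdx F (fun i j => by simp only [F]; ring)
    (fun i => by simp only [F, σ, τ, hsq]; ring)
  have hFe : ∀ e : EdgeIdx (2 * n), (if Separates A e
        then (if Separates S e then 0 else c)
        else (if Separates S e then d else 0)) = F e.1.1 e.1.2 := by
    intro e
    simp only [F, σ, τ, signOf, Separates]
    by_cases h1 : e.1.1 ∈ A <;> by_cases h2 : e.1.2 ∈ A <;>
    by_cases h3 : e.1.1 ∈ S <;> by_cases h4 : e.1.2 ∈ S <;>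
      simp [h1, h2, h3, h4] <;> ring
  have hdouble : ∑ i, ∑ j, F i j = ((c + d) * (2 * n) ^ 2
      + (d - c) * (∑ i, σ i) ^ 2 + (c - d) * (∑ i, τ i) ^ 2
      - (c + d) * (∑ i, σ i * τ i) ^ 2) / 4 := by
    have hF : ∀ i j, F i j = (c + d) / 4 + (d - c) / 4 * (σ i * σ j)
        + (c - d) / 4 * (τ i * τ j) - (c + d) / 4 * ((σ i * τ i) * (σ j * τ j)) := by
      intro i j; simp only [F]; ring
    simp_rw [hF, Finset.sum_sub_distrib, Finset.sum_add_distrib, ← Finset.mul_sum,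
      ← Finset.sum_mul]
    simp
    ring
  have hσ : ∑ i, σ i = 0 := by simp only [σ, sum_signOf, hA]; push_cast; ring
  have hτ : ∑ i, τ i = 0 := by simp only [τ, sum_signOf, hS]; push_cast; ring
  have hστ : ∑ i, σ i * τ i = 2 * n - 4 * m := by
    simp only [σ, τ, sum_signOf_mul, hm', ← hm]; push_cast; ring
  rw [hdouble, hσ, hτ, hστ] at hsum
  simp_rw [hFe]
  linear_combination hsum / 2

lemma prob_cut_le {n : ℕ} {a b : ℝ} (hb : 0 < b) (hab : b ≤ a) (han : a ≤ n)
    {S : Finset (Fin (2 * n))} (hS : S.card = n) :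
    (sbm2 n a b).real {ω | cutSize ω S ≤ cutSize ω (block1 n)} ≤
      Real.exp (-((√a - √b) ^ 2 *
        (2 * (block1 n \ S).card * (n - (block1 n \ S).card) / n))) := by
  have ha : 0 < a := hb.trans_le hab
  have hsa : 0 < √a := Real.sqrt_pos.2 ha
  have hsb : 0 < √b := Real.sqrt_pos.2 hb
  have ht : 1 ≤ √a / √b := by
    rw [one_le_div hsb]; exact Real.sqrt_le_sqrt hab
  have h := prob_cut_le_exp_sum ha hb han (hab.trans han) ht S
  rw [sum_separation_weights (card_block1 n) hS] at h
  refine h.trans_eq (congrArg Real.exp ?_)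
  have hn : (n : ℝ) ≠ 0 := (ha.trans_le han).ne'
  have e1 : b * (√a / √b - 1) + a * ((√a / √b)⁻¹ - 1) = -(√a - √b) ^ 2 := by
    have h1 := Real.sq_sqrt ha.le
    have h2 := Real.sq_sqrt hb.le
    generalize √a = x at *
    generalize √b = y at *
    subst h1 h2
    field_simp
    ring
  rw [← add_div, e1]
  ring

lemma card_filter_sdiff_le {n : ℕ} {A : Finset (Fin (2 * n))} (hA : A.card = n) (m : ℕ) :
    ((univ.powersetCard n).filter fun S => (A \ S).card = m).card ≤ n.choose m ^ 2 := by
  have hAc : Aᶜ.card = n := by rw [card_compl, hA, Fintype.card_fin]; omega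
  have hcard : (A.powersetCard m ×ˢ Aᶜ.powersetCard m).card = n.choose m ^ 2 := by
    rw [card_product, card_powersetCard, card_powersetCard, hA, hAc, sq]
  rw [← hcard]
  refine card_le_card_of_injOn (fun S => (A \ S, S \ A)) ?_ ?_
  · intro S hS
    simp only [coe_filter, mem_powersetCard, Set.mem_ofPred_eq, subset_univ, true_and] at hS
    simp only [mem_coe, mem_product, mem_powersetCard]
    refine ⟨⟨sdiff_subset, hS.2⟩, ?_, ?_⟩
    · intro x hx
      exact mem_compl.2 (mem_sdiff.1 hx).2
    · rw [← hS.2]; exact card_sdiff_comm (hS.1.trans hA.symm)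
  · intro S _ T _ h
    obtain ⟨hAS, hSA⟩ := Prod.mk.inj h
    ext x
    have h1 := Finset.ext_iff.1 hAS x
    have h2 := Finset.ext_iff.1 hSA x
    simp only [Finset.mem_sdiff] at h1 h2
    tauto

lemma choose_le_exp {n k : ℕ} {γ : ℝ} (hγ : 0 < γ) (hk : γ * n ≤ k) (hk0 : 0 < k) :
    (n.choose k : ℝ) ≤ Real.exp (k * (1 + Real.log (1 / γ))) := by
  have hkr : (0 : ℝ) < k := by exact_mod_cast hk0
  have h1 := Nat.choose_le_pow_div (α := ℝ) k n
  have h2 := Real.pow_div_factorial_le_exp (k : ℝ) hkr.le k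
  have hn : (n : ℝ) ≤ k * (1 / γ) := by
    rw [mul_one_div, le_div_iff₀ hγ]; linarith
  calc (n.choose k : ℝ) ≤ n ^ k / k.factorial := h1
    _ ≤ (k * (1 / γ)) ^ k / k.factorial := by gcongr
    _ = (k ^ k / k.factorial) * (1 / γ) ^ k := by rw [mul_pow]; ring
    _ ≤ Real.exp k * (1 / γ) ^ k := by gcongr
    _ = _ := by
      rw [mul_add, Real.exp_add, mul_one, mul_comm (k : ℝ) (Real.log _), Real.exp_mul,
        Real.exp_log (by positivity), Real.rpow_natCast]

lemma choose_sq_mul_exp_le {n m : ℕ} {γ s : ℝ} (hγ : 0 < γ) (hγ1 : γ < 1)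
    (hs : 4.05 * Real.log (2 / γ) ≤ s) (hmn : m ≤ n) (h1 : γ * n < m) (h2 : γ * n < n - m) :
    (n.choose m : ℝ) ^ 2 * Real.exp (-(s * (2 * m * (n - m) / n))) ≤
      Real.exp (-(0.8 * γ * n)) := by
  wlog hle : 2 * m ≤ n generalizing m
  · have := this (m := n - m) (by omega) (by push_cast [hmn]; linarith)
      (by push_cast [hmn]; linarith) (by omega)
    rw [Nat.choose_symm hmn] at this
    push_cast [hmn] at this
    convert this using 5
    ring
  have hn0 : (0 : ℝ) ≤ n := by positivity
  have hm0 : (0 : ℝ) < m := lt_of_le_of_lt (by positivity) h1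
  have hmN : 0 < m := by exact_mod_cast hm0
  have hn : (0 : ℝ) < n := by exact_mod_cast (by omega : 0 < n)
  have hlr : (2 : ℝ) * m ≤ n := by exact_mod_cast hle
  have hlog : Real.log (2 / γ) = Real.log 2 + Real.log (1 / γ) := by
    rw [← Real.log_mul (by norm_num) (by positivity)]; congr 1; ring
  have hlog0 : 0 ≤ Real.log (1 / γ) := Real.log_nonneg (by rw [one_le_div hγ]; exact hγ1.le)
  have hl2 := Real.log_two_gt_d9
  have hs' : 2.8 + 2 * Real.log (1 / γ) ≤ s := by rw [hlog] at hs; linarith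
  have hm : (m : ℝ) ≤ 2 * m * (n - m) / n := by
    rw [le_div_iff₀ hn]; nlinarith
  calc (n.choose m : ℝ) ^ 2 * Real.exp (-(s * (2 * m * (n - m) / n)))
      ≤ Real.exp (m * (1 + Real.log (1 / γ))) ^ 2 * Real.exp (-(s * m)) := by
        gcongr
        · exact choose_le_exp hγ h1.le hmN
        · linarith
    _ = Real.exp (m * (2 + 2 * Real.log (1 / γ) - s)) := by
        rw [← Real.exp_nat_mul, ← Real.exp_add]; congr 1; push_cast; ring
    _ ≤ _ := by
        apply Real.exp_le_exp.2
        nlinarith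

lemma le_sqrt_sub_sqrt_sq {a b : ℝ} (ha : 0 < a) (hb : 0 < b) :
    (a - b) ^ 2 / (a + b) / 2 ≤ (√a - √b) ^ 2 := by
  have h1 := Real.sq_sqrt ha.le
  have h2 := Real.sq_sqrt hb.le
  have hx := Real.sqrt_pos.2 ha
  generalize √a = x at *
  generalize √b = y at *
  subst h1 h2
  rw [div_div, div_le_iff₀ (by positivity)]
  have : (x ^ 2 - y ^ 2) ^ 2 = (x - y) ^ 2 * (x + y) ^ 2 := by ring
  rw [this]
  gcongr
  nlinarith [sq_nonneg (x - y)]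

/-- A set of half of the vertices minimizing the cut size. -/
noncomputable def minBisection (n : ℕ) (ω : Config (2 * n)) : Finset (Fin (2 * n)) :=
  (exists_min_image (univ.powersetCard n) (cutSize ω)
    (powersetCard_nonempty.2 (by rw [card_univ, Fintype.card_fin]; omega))).choose

lemma card_minBisection (n : ℕ) (ω : Config (2 * n)) : (minBisection n ω).card = n :=
  (mem_powersetCard_univ.1 (exists_min_image (univ.powersetCard n) (cutSize ω)
    (powersetCard_nonempty.2 (by rw [card_univ, Fintype.card_fin]; omega))).choose_spec.1)

lemma cutSize_minBisection_le {n : ℕ} (ω : Config (2 * n)) {S : Finset (Fin (2 * n))}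
    (hS : S.card = n) : cutSize ω (minBisection n ω) ≤ cutSize ω S :=
  (exists_min_image (univ.powersetCard n) (cutSize ω)
    (powersetCard_nonempty.2 (by rw [card_univ, Fintype.card_fin]; omega))).choose_spec.2 S
      (mem_powersetCard_univ.2 hS)

lemma block2_eq_compl (n : ℕ) : block2 n = (block1 n)ᶜ := by
  ext; simp [block1, block2]

lemma correct2_or_swap {n : ℕ} {γ : ℝ} {S : Finset (Fin (2 * n))} (hS : S.card = n)
    (h : ((block1 n \ S).card : ℝ) ≤ γ * n ∨ (n : ℝ) - (block1 n \ S).card ≤ γ * n) :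
    correct2 n γ (S, Sᶜ) ∨ correct2 n γ (S, Sᶜ).swap := by
  have hA := card_block1 n
  have e1 : (block1 n ∩ S).card + (block1 n \ S).card = n := by
    rw [card_inter_add_card_sdiff, hA]
  have e2 : (S \ block1 n).card = (block1 n \ S).card := card_sdiff_comm (hS.trans hA.symm)
  have e3 : (block2 n ∩ S) = S \ block1 n := by
    ext; simp [block2_eq_compl, and_comm]
  have e4 : (block1 n ∩ Sᶜ) = block1 n \ S := by ext; simp
  have e5 : (block2 n ∩ S).card + (block2 n ∩ Sᶜ).card = n := by
    have : block2 n ∩ Sᶜ = block2 n \ S := by ext; simp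
    rw [this, card_inter_add_card_sdiff, block2_eq_compl, card_compl, hA, Fintype.card_fin]
    omega
  rw [e3, e2] at e5
  have e1' : ((block1 n ∩ S).card : ℝ) + (block1 n \ S).card = n := by exact_mod_cast e1
  have e5' : ((block1 n \ S).card : ℝ) + (block2 n ∩ Sᶜ).card = n := by exact_mod_cast e5
  rcases h with h | h
  · left; constructor <;> simp only <;> linarith
  · right; constructor <;> simp only [Prod.swap, e3, e4, e2] <;> linarith

lemma prob_minBisection_wrong_le {n : ℕ} {a b γ : ℝ} (hb : 0 < b) (hab : b ≤ a) (han : a ≤ n)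
    (hγ : 0 < γ) (hγ1 : γ < 1) (h : 8.1 * Real.log (2 / γ) ≤ (a - b) ^ 2 / (a + b)) :
    (sbm2 n a b).real {ω | correct2 n γ (minBisection n ω, (minBisection n ω)ᶜ) ∨
      correct2 n γ (minBisection n ω, (minBisection n ω)ᶜ).swap}ᶜ ≤
      (n + 1) * Real.exp (-(0.8 * γ * n)) := by
  have : IsProbabilityMeasure (sbm2 n a b) := by unfold sbm2; infer_instance
  set s := (√a - √b) ^ 2
  have hs : 4.05 * Real.log (2 / γ) ≤ s := by
    have := le_sqrt_sub_sqrt_sq (hb.trans_le hab) hb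
    linarith
  let wrong : Finset ℕ := (range (n + 1)).filter fun m => γ * n < m ∧ γ * n < (n : ℝ) - m
  let T : ℕ → Finset (Finset (Fin (2 * n))) := fun m =>
    (univ.powersetCard n).filter fun S => (block1 n \ S).card = m
  let E : Finset (Fin (2 * n)) → Set (Config (2 * n)) := fun S =>
    {ω | cutSize ω S ≤ cutSize ω (block1 n)}
  have hsub : {ω | correct2 n γ (minBisection n ω, (minBisection n ω)ᶜ) ∨
      correct2 n γ (minBisection n ω, (minBisection n ω)ᶜ).swap}ᶜ ⊆
      ⋃ m ∈ wrong, ⋃ S ∈ T m, E S := by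
    intro ω hω
    have hω' := mt (correct2_or_swap (γ := γ) (card_minBisection n ω)) hω
    push Not at hω'
    simp only [Set.mem_iUnion]
    refine ⟨_, mem_filter.2 ⟨?_, hω'⟩, minBisection n ω, ?_,
      cutSize_minBisection_le ω (card_block1 n)⟩
    · have := card_le_card (sdiff_subset (s := block1 n) (t := minBisection n ω))
      rw [card_block1] at this
      exact mem_range.2 (by omega)
    · exact mem_filter.2 ⟨mem_powersetCard_univ.2 (card_minBisection n ω), rfl⟩
  calc _ ≤ (sbm2 n a b).real (⋃ m ∈ wrong, ⋃ S ∈ T m, E S) :=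
        measureReal_mono hsub (measure_ne_top _ _)
    _ ≤ ∑ m ∈ wrong, (sbm2 n a b).real (⋃ S ∈ T m, E S) := measureReal_biUnion_finset_le _ _
    _ ≤ ∑ m ∈ wrong, ∑ S ∈ T m, (sbm2 n a b).real (E S) :=
        sum_le_sum fun m _ => measureReal_biUnion_finset_le _ _
    _ ≤ ∑ m ∈ wrong, ∑ S ∈ T m, Real.exp (-(s * (2 * m * (n - m) / n))) := by
        refine sum_le_sum fun m _ => sum_le_sum fun S hS => ?_
        obtain ⟨hS1, hS2⟩ := mem_filter.1 hS
        have := prob_cut_le hb hab han (mem_powersetCard_univ.1 hS1)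
        rwa [hS2] at this
    _ ≤ ∑ m ∈ wrong, Real.exp (-(0.8 * γ * n)) := by
        refine sum_le_sum fun m hm => ?_
        obtain ⟨hm1, hm2, hm3⟩ := mem_filter.1 hm
        rw [sum_const, nsmul_eq_mul]
        refine le_trans ?_ (choose_sq_mul_exp_le hγ hγ1 hs
          (Nat.lt_succ_iff.1 (mem_range.1 hm1)) hm2 hm3)
        gcongr
        exact_mod_cast card_filter_sdiff_le (card_block1 n) m
    _ ≤ _ := by
        rw [sum_const, nsmul_eq_mul]
        gcongr
        have : wrong.card ≤ n + 1 := (card_filter_le _ _).trans_eq (card_range _)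
        exact_mod_cast this

lemma tendsto_add_one_mul_exp_neg {c : ℝ} (hc : 0 < c) :
    Tendsto (fun n : ℕ => ((n : ℝ) + 1) * Real.exp (-(c * n))) atTop (nhds 0) := by
  have hcn : Tendsto (fun n : ℕ => c * (n : ℝ)) atTop atTop :=
    tendsto_natCast_atTop_atTop.const_mul_atTop hc
  have h1 := ((Real.tendsto_pow_mul_exp_neg_atTop_nhds_zero 1).comp hcn).const_mul c⁻¹
  have h2 := (Real.tendsto_pow_mul_exp_neg_atTop_nhds_zero 0).comp hcn
  have h3 := h1.add h2
  simp only [mul_zero, add_zero] at h3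
  refine h3.congr fun n => ?_
  simp only [Function.comp_apply]
  field_simp

/-- Corollary 1.3 / `cor:main1`: there are absolute constants `C₀`
and `ε > 0` such that whenever `a > b > C₀`, `ε > γ > 0` and
`(a-b)²/(a+b) ≥ 8.1 log(2/γ)`, there is an estimator that, on a graph drawn from
`SBM(n,a,b)`, outputs a `γ`-correct partition (up to the labelling of the two blocks)
with probability `1 - o(1)` as `n → ∞`. -/
theorem sbm_gamma_correct_recovery_explicit_constant :
    ∃ C₀ ε : ℝ, 0 < ε ∧ ∀ a b γ : ℝ, C₀ < b → b < a → 0 < γ → γ < ε →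
      8.1 * Real.log (2 / γ) ≤ (a - b) ^ 2 / (a + b) →
      ∃ est : (n : ℕ) → Config (2 * n) → Finset (Fin (2 * n)) × Finset (Fin (2 * n)),
        (∀ n ω, isPartition2 (est n ω)) ∧
        Tendsto
          (fun n => sbm2 n a b
            {ω | correct2 n γ (est n ω) ∨ correct2 n γ (est n ω).swap})
          atTop (nhds 1) := by
  refine ⟨0, 1, one_pos, fun a b γ hb hab hγ hγ1 h => ?_⟩
  refine ⟨fun n ω => (minBisection n ω, (minBisection n ω)ᶜ),
    fun n ω => ⟨disjoint_compl_right, union_compl _⟩, ?_⟩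
  have hprob : ∀ n, IsProbabilityMeasure (sbm2 n a b) := fun n => by
    unfold sbm2; infer_instance
  have hlim : Tendsto
      (fun n : ℕ => ENNReal.ofReal (1 - ((n : ℝ) + 1) * Real.exp (-(0.8 * γ * n))))
      atTop (nhds 1) := by
    have := (tendsto_add_one_mul_exp_neg (c := 0.8 * γ) (by positivity)).const_sub 1
    simpa using ENNReal.tendsto_ofReal this
  refine tendsto_of_tendsto_of_tendsto_of_le_of_le' hlim tendsto_const_nhds ?_
    (Eventually.of_forall fun n => prob_le_one)
  filter_upwards [eventually_ge_atTop ⌈a⌉₊] with n hn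
  have hwrong := prob_minBisection_wrong_le hb hab.le (Nat.ceil_le.1 hn) hγ hγ1 h
  rw [probReal_compl_eq_one_sub (Set.toFinite _).measurableSet] at hwrong
  rw [← ofReal_measureReal]
  exact ENNReal.ofReal_le_ofReal (by linarith)
end

section
/- There exist absolute constants C₀ and C₁ such that the following holds. For any constants a > b > C₀ and γ > 0 satisfying (a-b)²/(a+b) ≥ C₁/γ², the Spectral Partition procedure, applied to a graph drawn from the two-block stochastic block model SBM(n,a,b), outputs a γ-correct partition with probability 1 − o(1) as n → ∞. -/
open MeasureTheory Filter Finset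

lemma integral_exp_pi_bern_le {ι : Type*} [Fintype ι] {p : ι → ℝ} (h0 : ∀ e, 0 ≤ p e)
    (h1 : ∀ e, p e ≤ 1) (c : ι → ℝ) :
    ∫ ω, Real.exp (∑ e, c e * (if ω e = true then 1 else 0)) ∂(Measure.pi fun e => bern (p e))
      ≤ Real.exp (∑ e, p e * (Real.exp (c e) - 1)) := by
  simp_rw [Real.exp_sum]
  rw [integral_fintype_prod_eq_prod
    (f := fun e (x : Bool) => Real.exp (c e * (if x = true then 1 else 0)))]
  refine Finset.prod_le_prod (fun e _ => integral_nonneg fun x => (Real.exp_pos _).le) ?_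
  intro e _
  rw [integral_bern (h0 e) (h1 e)]
  have := Real.add_one_le_exp (p e * (Real.exp (c e) - 1))
  simp only [if_true, mul_one, Bool.false_eq_true, if_false, mul_zero, Real.exp_zero]
  linarith

lemma sum_sum_eq_sum_edgeIdx {N : ℕ} (f : Fin N → Fin N → ℝ) (hf : ∀ i, f i i = 0) :
    ∑ i, ∑ j, f i j = ∑ e : EdgeIdx N, (f e.1.1 e.1.2 + f e.1.2 e.1.1) := by
  have h1 : ∑ e : EdgeIdx N, (f e.1.1 e.1.2 + f e.1.2 e.1.1)
      = ∑ i, ∑ j, if i < j then f i j + f j i else 0 := by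
    rw [← Finset.sum_product', Finset.univ_product_univ, ← Finset.sum_filter]
    exact (Finset.sum_subtype _ (by simp) fun x : Fin N × Fin N => f x.1 x.2 + f x.2 x.1).symm
  have h2 : ∑ i, ∑ j, (if i < j then f i j + f j i else 0)
      = ∑ i, ∑ j, (if i < j then f i j else 0) + ∑ i, ∑ j, (if i < j then f j i else 0) := by
    simp_rw [← Finset.sum_add_distrib]
    refine Finset.sum_congr rfl fun i _ => Finset.sum_congr rfl fun j _ => ?_
    split_ifs <;> simp
  rw [h1, h2, Finset.sum_comm (f := fun i j => if i < j then f j i else 0)]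
  simp_rw [← Finset.sum_add_distrib]
  refine Finset.sum_congr rfl fun i _ => Finset.sum_congr rfl fun j _ => ?_
  rcases lt_trichotomy i j with h | h | h
  · simp [h, h.not_gt]
  · subst h; simp [hf]
  · simp [h, h.not_gt]

lemma adjMat_self {N : ℕ} (ω : Config N) (i : Fin N) : adjMat ω i i = 0 := by
  simp [adjMat, adjOf]

lemma adjMat_symm {N : ℕ} (ω : Config N) (i j : Fin N) : adjMat ω i j = adjMat ω j i := by
  unfold adjMat adjOf
  rcases lt_trichotomy i j with h | h | h
  · simp [h, h.not_gt]
  · subst h; rfl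
  · simp [h, h.not_gt]

lemma adjMat_nonneg {N : ℕ} (ω : Config N) (i j : Fin N) : 0 ≤ adjMat ω i j := by
  unfold adjMat; split_ifs <;> norm_num

lemma adjMat_of_lt {N : ℕ} (ω : Config N) (e : EdgeIdx N) :
    adjMat ω e.1.1 e.1.2 = if ω e = true then 1 else 0 := by
  have := e.2
  simp [adjMat, adjOf, this]

lemma expAdj_symm (n : ℕ) (a b : ℝ) (i j : Fin (2 * n)) : expAdj n a b i j = expAdj n a b j i := by
  unfold expAdj
  simp only [eq_comm (a := i), iff_comm (a := (i : ℕ) < n)]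

lemma expAdj_nonneg {n : ℕ} {a b : ℝ} (hb : 0 ≤ b) (hba : b ≤ a) (i j : Fin (2 * n)) :
    0 ≤ expAdj n a b i j := by
  have : 0 ≤ a := hb.trans hba
  unfold expAdj; split_ifs <;> positivity

lemma expAdj_le {n : ℕ} {a b : ℝ} (hb : 0 ≤ b) (hba : b ≤ a) (i j : Fin (2 * n)) :
    expAdj n a b i j ≤ (a + b) / n := by
  have : 0 ≤ a := hb.trans hba
  unfold expAdj; split_ifs
  · positivity
  · gcongr; linarith
  · gcongr; linarith

lemma exp_add_le_half (x y : ℝ) :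
    Real.exp (x + y) ≤ (Real.exp (2 * x) + Real.exp (2 * y)) / 2 := by
  rw [Real.exp_add, two_mul, two_mul, Real.exp_add, Real.exp_add]
  nlinarith [sq_nonneg (Real.exp x - Real.exp y)]

instance (n : ℕ) (a b : ℝ) : IsProbabilityMeasure (sbm2 n a b) := by
  unfold sbm2; infer_instance

/-- Chernoff bound for a linear statistic of the adjacency matrix. -/
lemma sbm2_tail {n : ℕ} {a b : ℝ} (hb : 0 ≤ b) (hba : b ≤ a) (hn : a ≤ n)
    (w : Fin (2 * n) → Fin (2 * n) → ℝ) {H X : ℝ}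
    (hX : (∑ i, ∑ j, expAdj n a b i j * (Real.exp (2 * w i j) - 1)) / 2 + H ≤ X) :
    sbm2 n a b {ω | X ≤ ∑ i, ∑ j, adjMat ω i j * w i j} ≤ ENNReal.ofReal (Real.exp (-H)) := by
  have ha : 0 ≤ a := hb.trans hba
  set p : EdgeIdx (2 * n) → ℝ := fun e =>
    if ((e.1.1 : ℕ) < n ↔ (e.1.2 : ℕ) < n) then a / n else b / n with hp
  have hp' : ∀ e : EdgeIdx (2 * n), expAdj n a b e.1.1 e.1.2 = p e := by
    intro e
    have := e.2.ne
    simp only [expAdj, hp, if_neg this]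
  have h0 : ∀ e, 0 ≤ p e := fun e => by rw [← hp']; exact expAdj_nonneg hb hba _ _
  have h1 : ∀ e, p e ≤ 1 := by
    intro e
    simp only [hp]
    split_ifs
    · exact div_le_one_of_le₀ hn (by positivity)
    · exact div_le_one_of_le₀ (hba.trans hn) (by positivity)
  set c : EdgeIdx (2 * n) → ℝ := fun e => w e.1.1 e.1.2 + w e.1.2 e.1.1 with hc
  have hY : ∀ ω : Config (2 * n), ∑ i, ∑ j, adjMat ω i j * w i j
      = ∑ e, c e * (if ω e = true then 1 else 0) := by
    intro ω
    rw [sum_sum_eq_sum_edgeIdx _ (fun i => by rw [adjMat_self, zero_mul])]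
    refine Finset.sum_congr rfl fun e _ => ?_
    rw [adjMat_symm ω e.1.2, adjMat_of_lt, hc]; ring
  have hE : ∑ e, p e * (Real.exp (c e) - 1) ≤
      (∑ i, ∑ j, expAdj n a b i j * (Real.exp (2 * w i j) - 1)) / 2 := by
    rw [sum_sum_eq_sum_edgeIdx _ (fun i => by simp [expAdj]), Finset.sum_div]
    refine Finset.sum_le_sum fun e _ => ?_
    rw [expAdj_symm n a b e.1.2, hp', hc]
    have : Real.exp (w e.1.1 e.1.2 + w e.1.2 e.1.1)
        ≤ (Real.exp (2 * w e.1.1 e.1.2) + Real.exp (2 * w e.1.2 e.1.1)) / 2 := by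
      exact exp_add_le_half _ _
    nlinarith [mul_le_mul_of_nonneg_left this (h0 e)]
  have key := ProbabilityTheory.measure_ge_le_exp_mul_mgf (μ := sbm2 n a b)
    (X := fun ω => ∑ e, c e * (if ω e = true then (1 : ℝ) else 0)) (t := 1) X zero_le_one
    Integrable.of_finite
  have hm := integral_exp_pi_bern_le h0 h1 c
  simp_rw [hY]
  rw [← ofReal_measureReal (measure_ne_top _ _)]
  refine ENNReal.ofReal_le_ofReal (key.trans ?_)
  unfold ProbabilityTheory.mgf
  simp only [one_mul, neg_one_mul, sbm2]
  calc _ ≤ Real.exp (-X) * Real.exp (∑ e, p e * (Real.exp (c e) - 1)) := by gcongr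
    _ = Real.exp (-X + ∑ e, p e * (Real.exp (c e) - 1)) := (Real.exp_add _ _).symm
    _ ≤ _ := by apply Real.exp_le_exp.mpr; linarith

lemma Int.abs_le_sq (k : ℤ) : |k| ≤ k ^ 2 := by
  rw [← sq_abs]; exact Int.le_self_sq |k|

/-- Integer vectors of squared length at most `4 * N`. -/
noncomputable def intVecs (N : ℕ) : Finset (Fin N → ℤ) :=
  (Fintype.piFinset fun _ => Icc (-(4 * N : ℤ)) (4 * N)).filter
    fun z => ∑ i, z i ^ 2 ≤ 4 * N

lemma mem_intVecs {N : ℕ} {z : Fin N → ℤ} : z ∈ intVecs N ↔ ∑ i, z i ^ 2 ≤ 4 * N := by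
  simp only [intVecs, mem_filter, Fintype.mem_piFinset, mem_Icc, and_iff_right_iff_imp]
  intro h i
  have h1 : z i ^ 2 ≤ 4 * N :=
    (single_le_sum (f := fun i => z i ^ 2) (fun j _ => sq_nonneg (z j)) (mem_univ i)).trans h
  have h2 := abs_le.mp ((Int.abs_le_sq (z i)).trans h1)
  exact h2

lemma sum_sq_of_mem_intVecs {N : ℕ} {z : Fin N → ℤ} (hz : z ∈ intVecs N) :
    ∑ i, (z i : ℝ) ^ 2 ≤ 4 * N := by
  exact_mod_cast mem_intVecs.mp hz

lemma sum_Icc_half_pow_le (M : ℕ) :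
    ∑ k ∈ Icc (-(M : ℤ)) M, ((1 : ℝ) / 2) ^ k.natAbs ≤ 3 - 2 * (1 / 2) ^ M := by
  induction M with
  | zero => norm_num
  | succ M ih =>
    have h : Icc (-((M + 1 : ℕ) : ℤ)) ((M + 1 : ℕ) : ℤ)
        = insert (-((M + 1 : ℕ) : ℤ)) (insert ((M + 1 : ℕ) : ℤ) (Icc (-(M : ℤ)) M)) := by
      ext k; simp only [mem_Icc, mem_insert]; push_cast; omega
    rw [h, sum_insert (by simp only [mem_insert, mem_Icc]; push_cast; omega),
      sum_insert (by simp only [mem_Icc]; push_cast; omega)]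
    rw [Int.natAbs_neg, Int.natAbs_natCast, pow_succ]
    linarith

lemma card_intVecs_le (N : ℕ) : ((intVecs N).card : ℝ) ≤ Real.exp (4 * N) := by
  have h1 : ((intVecs N).card : ℝ) ≤ ∑ z ∈ intVecs N, (2 : ℝ) ^ (4 * N) *
      ∏ i, ((1 : ℝ) / 2) ^ (z i).natAbs := by
    rw [card_eq_sum_ones, Nat.cast_sum]
    refine sum_le_sum fun z hz => ?_
    rw [prod_pow_eq_pow_sum]
    have h2 : ∑ i, (z i).natAbs ≤ 4 * N := by
      have := mem_intVecs.mp hz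
      zify
      refine le_trans (sum_le_sum fun i _ => ?_) this
      exact Int.abs_le_sq (z i)
    have h3 : ((1 : ℝ) / 2) ^ (4 * N) ≤ (1 / 2) ^ (∑ i, (z i).natAbs) :=
      pow_le_pow_of_le_one (by norm_num) (by norm_num) h2
    calc ((1 : ℕ) : ℝ) = 2 ^ (4 * N) * (1 / 2) ^ (4 * N) := by
          rw [← mul_pow]; norm_num
      _ ≤ _ := by gcongr
  have h4 : ∑ z ∈ intVecs N, (2 : ℝ) ^ (4 * N) * ∏ i, ((1 : ℝ) / 2) ^ (z i).natAbs
      ≤ ∑ z ∈ (Fintype.piFinset fun _ : Fin N => Icc (-(4 * N : ℤ)) (4 * N)),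
        (2 : ℝ) ^ (4 * N) * ∏ i, ((1 : ℝ) / 2) ^ (z i).natAbs :=
    sum_le_sum_of_subset_of_nonneg (filter_subset _ _) fun z _ _ => by positivity
  rw [← mul_sum (Fintype.piFinset _),
    ← prod_univ_sum (fun _ => Icc (-(4 * N : ℤ)) (4 * N))
      fun _ (k : ℤ) => ((1 : ℝ) / 2) ^ k.natAbs] at h4
  have h5 : ∑ k ∈ Icc (-(4 * N : ℤ)) (4 * N), ((1 : ℝ) / 2) ^ k.natAbs ≤ 3 := by
    have := sum_Icc_half_pow_le (4 * N)
    push_cast at this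
    have h6 : (0 : ℝ) ≤ (1 / 2) ^ (4 * N) := by positivity
    linarith
  refine (h1.trans h4).trans ?_
  rw [prod_const, card_univ, Fintype.card_fin, pow_mul, ← mul_pow]
  have h7 : (0 : ℝ) ≤ ∑ k ∈ Icc (-(4 * N : ℤ)) (4 * N), ((1 : ℝ) / 2) ^ k.natAbs :=
    sum_nonneg fun _ _ => by positivity
  have h8 : Real.exp (4 * N) = (Real.exp 1 ^ 4) ^ N := by
    rw [← Real.exp_nat_mul, ← Real.exp_nat_mul]; congr 1; push_cast; ring
  rw [h8]
  refine pow_le_pow_left₀ (by positivity) ?_ N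
  have h9 : (2.7 : ℝ) < Real.exp 1 := by have := Real.exp_one_gt_d9; linarith
  have h10 : (2.7 : ℝ) ^ 4 ≤ Real.exp 1 ^ 4 := by gcongr
  norm_num at h10 ⊢
  linarith

/-- The products `z i * w j`, truncated to those of size at most `τ`. -/
noncomputable def lightProd {N : ℕ} (τ : ℝ) (z w : Fin N → ℤ) (i j : Fin N) : ℝ :=
  if |(z i : ℝ) * w j| ≤ τ then (z i : ℝ) * w j else 0

lemma abs_lightProd_le {N : ℕ} {τ : ℝ} (hτ : 0 ≤ τ) (z w : Fin N → ℤ) (i j : Fin N) :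
    |lightProd τ z w i j| ≤ τ := by
  unfold lightProd; split_ifs with h
  · exact h
  · simpa using hτ

lemma lightProd_sq_le {N : ℕ} (τ : ℝ) (z w : Fin N → ℤ) (i j : Fin N) :
    lightProd τ z w i j ^ 2 ≤ (z i : ℝ) ^ 2 * (w j : ℝ) ^ 2 := by
  unfold lightProd; split_ifs with h
  · rw [mul_pow]
  · rw [zero_pow two_ne_zero]; positivity

lemma exp_sub_one_le_of_abs_le_one {x : ℝ} (hx : |x| ≤ 1) : Real.exp x - 1 ≤ x + x ^ 2 := by
  have := abs_le.mp (Real.abs_exp_sub_one_sub_id_le hx)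
  linarith [this.2]

lemma sum_mul_sq_le {N : ℕ} {z w : Fin N → ℤ} (hz : z ∈ intVecs N) (hw : w ∈ intVecs N) :
    ∑ i, ∑ j, (z i : ℝ) ^ 2 * (w j : ℝ) ^ 2 ≤ 16 * (N : ℝ) ^ 2 := by
  rw [← sum_mul_sum]
  calc _ ≤ (4 * N : ℝ) * (4 * N) :=
        mul_le_mul (sum_sq_of_mem_intVecs hz) (sum_sq_of_mem_intVecs hw)
          (sum_nonneg fun _ _ => sq_nonneg _) (by positivity)
    _ = _ := by ring

lemma sbm2_lightProd_tail {n : ℕ} {a b : ℝ} (hb : 0 < b) (hba : b ≤ a) (hn : a ≤ n)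
    {z w : Fin (2 * n) → ℤ} (hz : z ∈ intVecs (2 * n)) (hw : w ∈ intVecs (2 * n)) :
    sbm2 n a b {ω | 160 * √(a + b) * n <
        ∑ i, ∑ j, (adjMat ω i j - expAdj n a b i j) * lightProd (4 * √(a + b)) z w i j}
      ≤ ENNReal.ofReal (Real.exp (-(18 * n))) := by
  have hd : 0 < a + b := by linarith
  have hn0 : (0 : ℝ) < n := by linarith
  set s := √(a + b) with hs
  have hs0 : 0 < s := Real.sqrt_pos.mpr hd
  have hss : s ^ 2 = a + b := Real.sq_sqrt hd.le
  set L := lightProd (4 * s) z w with hL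
  have hX : (∑ i, ∑ j, expAdj n a b i j * (Real.exp (2 * (L i j / (8 * s))) - 1)) / 2 + 18 * n
      ≤ ∑ i, ∑ j, expAdj n a b i j * (L i j / (8 * s)) + 20 * n := by
    have h1 : ∀ i j, expAdj n a b i j * (Real.exp (2 * (L i j / (8 * s))) - 1) ≤
        2 * (expAdj n a b i j * (L i j / (8 * s))) + ((z i : ℝ) ^ 2 * (w j : ℝ) ^ 2) / (16 * n) := by
      intro i j
      have h2 : |2 * (L i j / (8 * s))| ≤ 1 := by
        have := abs_lightProd_le (by positivity : 0 ≤ 4 * s) z w i j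
        rw [abs_mul, abs_div, abs_of_pos (by positivity : 0 < 8 * s), abs_two, mul_div_assoc',
          div_le_one (by positivity)]
        linarith
      have h3 := exp_sub_one_le_of_abs_le_one h2
      have h4 := expAdj_nonneg (n := n) hb.le hba i j
      have h5 := expAdj_le (n := n) hb.le hba i j
      have h6 : expAdj n a b i j * (2 * (L i j / (8 * s))) ^ 2
          ≤ ((z i : ℝ) ^ 2 * (w j : ℝ) ^ 2) / (16 * n) := by
        calc expAdj n a b i j * (2 * (L i j / (8 * s))) ^ 2
            ≤ (a + b) / n * (2 * (L i j / (8 * s))) ^ 2 := by gcongr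
          _ = L i j ^ 2 / (16 * n) := by rw [← hss]; field_simp; ring
          _ ≤ _ := by gcongr; exact lightProd_sq_le _ _ _ _ _
      nlinarith [mul_le_mul_of_nonneg_left h3 h4]
    have h7 := sum_le_sum fun i (_ : i ∈ univ) => sum_le_sum fun j (_ : j ∈ univ) => h1 i j
    simp_rw [sum_add_distrib, ← mul_sum, ← sum_div, ← mul_sum] at h7
    have h8 := sum_mul_sq_le hz hw
    simp_rw [← mul_sum] at h8
    have h9 : (∑ i, (z i : ℝ) ^ 2 * ∑ j, (w j : ℝ) ^ 2) / (16 * n) ≤ 4 * n := by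
      rw [div_le_iff₀ (by positivity)]
      push_cast at h8
      nlinarith
    linarith
  refine le_trans (measure_mono ?_) (sbm2_tail hb.le hba hn (fun i j => L i j / (8 * s)) hX)
  intro ω hω
  simp only [Set.mem_ofPred_eq] at hω ⊢
  simp_rw [sub_mul, sum_sub_distrib] at hω
  simp_rw [mul_div_assoc', ← sum_div]
  have : (160 * s * n) / (8 * s) = 20 * n := by field_simp; norm_num
  rw [← this, ← add_div]
  gcongr
  linarith

lemma sbm2_exists_lightProd_tail {n : ℕ} {a b : ℝ} (hb : 0 < b) (hba : b ≤ a) (hn : a ≤ n) :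
    sbm2 n a b {ω | ∃ z ∈ intVecs (2 * n), ∃ w ∈ intVecs (2 * n), 160 * √(a + b) * n <
        ∑ i, ∑ j, (adjMat ω i j - expAdj n a b i j) * lightProd (4 * √(a + b)) z w i j}
      ≤ ENNReal.ofReal (Real.exp (-(2 * n))) := by
  have hsub : {ω : Config (2 * n) | ∃ z ∈ intVecs (2 * n), ∃ w ∈ intVecs (2 * n),
      160 * √(a + b) * n <
        ∑ i, ∑ j, (adjMat ω i j - expAdj n a b i j) * lightProd (4 * √(a + b)) z w i j}
      = ⋃ q ∈ intVecs (2 * n) ×ˢ intVecs (2 * n), {ω | 160 * √(a + b) * n <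
        ∑ i, ∑ j, (adjMat ω i j - expAdj n a b i j) * lightProd (4 * √(a + b)) q.1 q.2 i j} := by
    ext ω
    simp only [Set.mem_ofPred_eq, Set.mem_iUnion, mem_product, exists_prop, Prod.exists]
    constructor
    · rintro ⟨z, hz, w, hw, h⟩; exact ⟨z, w, ⟨hz, hw⟩, h⟩
    · rintro ⟨z, w, ⟨hz, hw⟩, h⟩; exact ⟨z, hz, w, hw, h⟩
  rw [hsub]
  refine (measure_biUnion_finset_le _ _).trans ?_
  refine (sum_le_sum fun q hq => sbm2_lightProd_tail hb hba hn (mem_product.mp hq).1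
    (mem_product.mp hq).2).trans ?_
  rw [sum_const, card_product, nsmul_eq_mul, ← ENNReal.ofReal_natCast,
    ← ENNReal.ofReal_mul (by positivity)]
  refine ENNReal.ofReal_le_ofReal ?_
  push_cast
  have := card_intVecs_le (2 * n)
  push_cast at this
  calc _ ≤ Real.exp (4 * (2 * n)) * Real.exp (4 * (2 * n)) * Real.exp (-(18 * n)) := by gcongr
    _ = Real.exp (-(2 * n)) := by rw [← Real.exp_add, ← Real.exp_add]; congr 1; ring

/-- An upper bound for the logarithm of the number of `s`-element subsets of an
`N`-element set. -/
noncomputable def entropyBound (N s : ℝ) : ℝ := s * (1 + Real.log (N / s))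

lemma entropyBound_nonneg {N s : ℝ} (hs : 0 ≤ s) (hsN : s ≤ N) : 0 ≤ entropyBound N s := by
  rcases hs.eq_or_lt with rfl | hs
  · simp [entropyBound]
  · have : 0 ≤ Real.log (N / s) := Real.log_nonneg ((one_le_div hs).mpr hsN)
    unfold entropyBound; positivity

lemma entropyBound_le {N s : ℝ} (hs : 0 ≤ s) (hN : 0 < N) : entropyBound N s ≤ N := by
  rcases hs.eq_or_lt with rfl | hs
  · simpa [entropyBound] using hN.le
  · have := Real.log_le_sub_one_of_pos (div_pos hN hs)
    unfold entropyBound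
    calc s * (1 + Real.log (N / s)) ≤ s * (1 + (N / s - 1)) := by gcongr
      _ = N := by field_simp; ring

lemma log_le_entropyBound {N s : ℝ} (hs : 1 ≤ s) (hsN : s ≤ N) :
    Real.log N ≤ entropyBound N s := by
  have hs0 : 0 < s := by linarith
  have hN0 : 0 < N := by linarith
  have h1 : 0 ≤ Real.log (N / s) := Real.log_nonneg ((one_le_div hs0).mpr hsN)
  have h2 := Real.log_le_sub_one_of_pos hs0
  have h3 : Real.log N = Real.log (N / s) + Real.log s := by
    rw [← Real.log_mul (by positivity) (by positivity)]; congr 1; field_simp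
  unfold entropyBound
  nlinarith

lemma choose_le_exp_entropyBound {N s : ℕ} (hs : 0 < s) (hsN : s ≤ N) :
    (N.choose s : ℝ) ≤ Real.exp (entropyBound N s) := by
  have hs' : (0 : ℝ) < s := by exact_mod_cast hs
  have hN' : (0 : ℝ) < N := by exact_mod_cast hs.trans_le hsN
  have h1 : ((s : ℝ) / N) ^ s * N.choose s ≤ ((s : ℝ) / N + 1) ^ N := by
    rw [add_pow]
    have := single_le_sum (f := fun m => ((s : ℝ) / N) ^ m * 1 ^ (N - m) * (N.choose m))
      (fun m _ => by positivity) (mem_range.mpr (Nat.lt_succ_of_le hsN))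
    simpa using this
  have h2 : ((s : ℝ) / N + 1) ^ N ≤ Real.exp s := by
    calc _ ≤ Real.exp ((s : ℝ) / N) ^ N := by gcongr; exact Real.add_one_le_exp _
      _ = _ := by rw [← Real.exp_nat_mul]; congr 1; field_simp
  have h3 : Real.exp (entropyBound N s) = Real.exp s * ((N : ℝ) / s) ^ s := by
    unfold entropyBound
    rw [mul_add, mul_one, Real.exp_add, Real.exp_nat_mul, Real.exp_log (by positivity)]
  rw [h3]
  calc (N.choose s : ℝ) = ((s : ℝ) / N) ^ s * N.choose s * ((N : ℝ) / s) ^ s := by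
        rw [mul_right_comm, ← mul_pow, div_mul_div_cancel₀ hN'.ne', div_self hs'.ne']; simp
    _ ≤ _ := by gcongr; exact h1.trans h2

lemma sum_exp_entropyBound_le (N : ℕ) (hN : 0 < N) :
    ∑ S : Finset (Fin N), (if S.card = 0 then 0 else Real.exp (-(3 * entropyBound N S.card)))
      ≤ 1 / N := by
  rw [← powerset_univ, sum_powerset_apply_card
    (fun m => if m = 0 then (0 : ℝ) else Real.exp (-(3 * entropyBound N m))),
    card_univ, Fintype.card_fin, sum_range_succ']
  simp only [Nat.add_eq_zero_iff, one_ne_zero, and_false, if_false, if_true, smul_zero, add_zero]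
  have hN' : (0 : ℝ) < N := by exact_mod_cast hN
  have h : ∀ m ∈ range N, N.choose (m + 1) • Real.exp (-(3 * entropyBound N (m + 1 : ℕ)))
      ≤ 1 / (N : ℝ) ^ 2 := by
    intro m hm
    have hm' : m + 1 ≤ N := mem_range.mp hm
    have h1 := choose_le_exp_entropyBound (Nat.succ_pos m) hm'
    have h2 : Real.log N ≤ entropyBound N (m + 1 : ℕ) :=
      log_le_entropyBound (by simp) (by exact_mod_cast hm')
    rw [nsmul_eq_mul]
    calc _ ≤ Real.exp (entropyBound N (m + 1 : ℕ)) *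
          Real.exp (-(3 * entropyBound N (m + 1 : ℕ))) := by gcongr
      _ = Real.exp (-(2 * entropyBound N (m + 1 : ℕ))) := by rw [← Real.exp_add]; ring_nf
      _ ≤ Real.exp (-(2 * Real.log N)) := by gcongr
      _ = 1 / (N : ℝ) ^ 2 := by
        rw [Real.exp_neg, one_div, mul_comm, Real.exp_mul, Real.exp_log hN']; norm_cast
  calc _ ≤ ∑ m ∈ range N, 1 / (N : ℝ) ^ 2 := sum_le_sum h
    _ = 1 / N := by rw [sum_const, card_range, nsmul_eq_mul]; field_simp

lemma eCountC_eq_sum {N : ℕ} (ω : Config N) (S T : Finset (Fin N)) :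
    eCountC ω S T = ∑ i, ∑ j, adjMat ω i j * (if i ∈ S ∧ j ∈ T then 1 else 0) := by
  unfold eCountC adjMat
  simp only [mul_ite, mul_one, mul_zero, ite_and]
  have h : ∀ i : Fin N, (∑ j, if i ∈ S then if j ∈ T then if adjOf ω i j = true then (1 : ℝ) else 0
      else 0 else 0) = if i ∈ S then ∑ j ∈ T, if adjOf ω i j = true then (1 : ℝ) else 0 else 0 := by
    intro i
    split_ifs
    · rw [sum_ite_mem, univ_inter]
    · simp
  simp_rw [h]
  rw [sum_ite_mem, univ_inter]

/-- Edge counts between all pairs of vertex sets obey a Chernoff bound for every tilt `l`. -/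
def EdgeDiscrepancy (n : ℕ) (d : ℝ) (ω : Config (2 * n)) : Prop :=
  ∀ S T : Finset (Fin (2 * n)), ∀ l : ℝ, 0 ≤ l →
    l / 2 * eCountC ω S T ≤ d / (2 * n) * S.card * T.card * Real.exp l
      + 3 * entropyBound (2 * n) S.card + 3 * entropyBound (2 * n) T.card

lemma sbm2_eCountC_tail {n : ℕ} {a b : ℝ} (hb : 0 < b) (hba : b ≤ a) (hn : a ≤ n)
    (S T : Finset (Fin (2 * n))) (H : ℝ) :
    sbm2 n a b {ω | ∃ l : ℝ, 0 ≤ l ∧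
        (a + b) / (2 * n) * S.card * T.card * Real.exp l + H < l / 2 * eCountC ω S T}
      ≤ ENNReal.ofReal (Real.exp (-H)) := by
  set B := {ω : Config (2 * n) | ∃ l : ℝ, 0 ≤ l ∧
        (a + b) / (2 * n) * S.card * T.card * Real.exp l + H < l / 2 * eCountC ω S T}
  rcases B.eq_empty_or_nonempty with hB | hB
  · rw [hB]; simp
  obtain ⟨ω₀, ⟨l, hl, h₀⟩, hmin⟩ := Set.exists_min_image B (fun ω => eCountC ω S T)
    (Set.toFinite _) hB
  have hX : (∑ i, ∑ j, expAdj n a b i j *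
      (Real.exp (2 * (l / 2 * (if i ∈ S ∧ j ∈ T then (1 : ℝ) else 0))) - 1)) / 2 + H
      ≤ l / 2 * eCountC ω₀ S T := by
    refine le_trans ?_ h₀.le
    have h1 : ∀ i j, expAdj n a b i j *
        (Real.exp (2 * (l / 2 * (if i ∈ S ∧ j ∈ T then (1 : ℝ) else 0))) - 1)
        ≤ (if i ∈ S then (1 : ℝ) else 0) * ((if j ∈ T then (1 : ℝ) else 0) *
          ((a + b) / n * Real.exp l)) := by
      intro i j
      have h4 := expAdj_nonneg (n := n) hb.le hba i j
      have h5 := expAdj_le (n := n) hb.le hba i j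
      by_cases hi : i ∈ S <;> by_cases hj : j ∈ T <;> simp only [hi, hj, and_self, and_true,
        and_false, if_true, if_false, mul_zero, zero_mul, one_mul, mul_one, Real.exp_zero,
        sub_self, le_refl]
      have h6 := Real.one_le_exp hl
      rw [show 2 * (l / 2) = l by ring]
      calc expAdj n a b i j * (Real.exp l - 1) ≤ expAdj n a b i j * Real.exp l := by
            gcongr; linarith
        _ ≤ _ := by gcongr
    have h7 := sum_le_sum fun i (_ : i ∈ univ) => sum_le_sum fun j (_ : j ∈ univ) => h1 i j
    simp_rw [← mul_sum, ← sum_mul] at h7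
    simp only [sum_ite_mem, univ_inter, sum_const, nsmul_eq_mul, mul_one] at h7
    calc _ ≤ (S.card * (T.card * ((a + b) / n * Real.exp l))) / 2 + H := by gcongr
      _ = _ := by ring
  refine le_trans (measure_mono ?_) (sbm2_tail hb.le hba hn
    (fun i j => l / 2 * (if i ∈ S ∧ j ∈ T then (1 : ℝ) else 0)) hX)
  intro ω hω
  have h := hmin ω hω
  simp only [Set.mem_ofPred_eq]
  simp_rw [mul_left_comm _ (l / 2), ← mul_sum, ← eCountC_eq_sum]
  gcongr

lemma sbm2_not_edgeDiscrepancy {n : ℕ} {a b : ℝ} (hb : 0 < b) (hba : b ≤ a) (hn : a ≤ n) :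
    sbm2 n a b {ω | ¬ EdgeDiscrepancy n (a + b) ω} ≤ ENNReal.ofReal (1 / n) := by
  have hn0 : (0 : ℝ) < n := by linarith
  have hn1 : 0 < n := by exact_mod_cast hn0
  set g : Finset (Fin (2 * n)) → ℝ := fun S =>
    if S.card = 0 then 0 else Real.exp (-(3 * entropyBound (2 * n : ℕ) S.card)) with hg
  have hg0 : ∀ S, 0 ≤ g S := fun S => by simp only [hg]; split_ifs <;> positivity
  have hcard : ∀ S : Finset (Fin (2 * n)), (S.card : ℝ) ≤ 2 * n := fun S => by
    have := card_le_univ S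
    rw [Fintype.card_fin] at this
    exact_mod_cast this
  have hsub : {ω : Config (2 * n) | ¬ EdgeDiscrepancy n (a + b) ω}
      ⊆ ⋃ q ∈ (univ : Finset (Finset (Fin (2 * n)) × Finset (Fin (2 * n)))), {ω |
        ∃ l : ℝ, 0 ≤ l ∧ (a + b) / (2 * n) * q.1.card * q.2.card * Real.exp l +
          (3 * entropyBound (2 * n) q.1.card + 3 * entropyBound (2 * n) q.2.card)
            < l / 2 * eCountC ω q.1 q.2} := by
    intro ω hω
    simp only [EdgeDiscrepancy, Set.mem_ofPred_eq, not_forall, not_le] at hω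
    obtain ⟨S, T, l, hl, h⟩ := hω
    simp only [Set.mem_iUnion, mem_univ, exists_prop, true_and, Set.mem_ofPred_eq]
    exact ⟨(S, T), l, hl, by linarith⟩
  refine (measure_mono hsub).trans ((measure_biUnion_finset_le _ _).trans ?_)
  have hq : ∀ q : Finset (Fin (2 * n)) × Finset (Fin (2 * n)), sbm2 n a b {ω |
        ∃ l : ℝ, 0 ≤ l ∧ (a + b) / (2 * n) * q.1.card * q.2.card * Real.exp l +
          (3 * entropyBound (2 * n) q.1.card + 3 * entropyBound (2 * n) q.2.card)
            < l / 2 * eCountC ω q.1 q.2} ≤ ENNReal.ofReal (g q.1 * g q.2) := by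
    rintro ⟨S, T⟩
    simp only
    rcases Nat.eq_zero_or_pos S.card with hS | hS
    · refine (measure_mono_null ?_ measure_empty).le.trans zero_le
      rintro ω ⟨l, hl, h⟩
      rw [card_eq_zero] at hS
      subst hS
      have := entropyBound_nonneg (Nat.cast_nonneg _) (hcard T)
      simp [eCountC, entropyBound] at h this
      linarith
    rcases Nat.eq_zero_or_pos T.card with hT | hT
    · refine (measure_mono_null ?_ measure_empty).le.trans zero_le
      rintro ω ⟨l, hl, h⟩
      rw [card_eq_zero] at hT
      subst hT
      have := entropyBound_nonneg (Nat.cast_nonneg _) (hcard S)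
      simp [eCountC, entropyBound] at h this
      linarith
    refine (sbm2_eCountC_tail hb hba hn S T _).trans (ENNReal.ofReal_le_ofReal ?_)
    simp only [hg, if_neg hS.ne', if_neg hT.ne']
    rw [← Real.exp_add]
    push_cast
    exact le_of_eq (by congr 1; ring)
  refine (sum_le_sum fun q _ => hq q).trans ?_
  rw [← ENNReal.ofReal_sum_of_nonneg fun q _ => mul_nonneg (hg0 _) (hg0 _)]
  refine ENNReal.ofReal_le_ofReal ?_
  rw [← univ_product_univ, sum_product, ← sum_mul_sum]
  have h := sum_exp_entropyBound_le (2 * n) (by omega)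
  have h0 : 0 ≤ ∑ S, g S := sum_nonneg fun S _ => hg0 S
  have hn2 : (1 : ℝ) ≤ n := by exact_mod_cast hn1
  have h' : ∑ S, g S ≤ 1 / n := by
    refine h.trans ?_
    push_cast
    gcongr
    linarith
  calc _ ≤ (1 / (n : ℝ)) * 1 := by
        refine mul_le_mul h' (h'.trans ?_) h0 (by positivity)
        exact div_le_one_of_le₀ hn2 hn0.le
    _ = _ := mul_one _

lemma mul_one_add_log_le {α q R l : ℝ} (hα : 0 < α) (hq : 0 < q) (hq1 : q ≤ 1) (hR : 0 < R)
    (hl : 1 ≤ l) (hlog : Real.log (R * √q / α) ≤ l) :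
    α * q * (1 + Real.log (R / (α * q))) ≤ 4 * l * (α * √q) := by
  have hs : 0 < √q := Real.sqrt_pos.mpr hq
  have hss : √q * √q = q := Real.mul_self_sqrt hq.le
  have hs1 : √q ≤ 1 := Real.sqrt_le_iff.mpr ⟨zero_le_one, by simpa using hq1⟩
  have h1 : R / (α * q) = R * √q / α * (1 / √q) ^ 3 := by
    rw [show α * q = α * (√q * √q) by rw [hss]]; field_simp
  have h2 : Real.log (R / (α * q)) ≤ l + 3 * (1 / √q - 1) := by
    rw [h1, Real.log_mul (by positivity) (by positivity), Real.log_pow]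
    have := Real.log_le_sub_one_of_pos (show 0 < 1 / √q by positivity)
    push_cast
    linarith
  have h3 : q * (1 + Real.log (R / (α * q))) ≤ 4 * l * √q := by
    have h4 : q * (1 / √q) = √q := by rw [mul_one_div]; exact Real.div_sqrt
    have h5 : q ≤ √q := by nlinarith
    calc q * (1 + Real.log (R / (α * q))) ≤ q * (1 + (l + 3 * (1 / √q - 1))) := by gcongr
      _ = q * l + 3 * (q * (1 / √q)) - 2 * q := by ring
      _ = q * l + 3 * √q - 2 * q := by rw [h4]
      _ ≤ 4 * l * √q := by nlinarith
  calc _ = α * (q * (1 + Real.log (R / (α * q)))) := by ring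
    _ ≤ α * (4 * l * √q) := by gcongr
    _ = _ := by ring

/-- The bound obtained by optimizing the tilt `l` for a single pair of dyadic levels. -/
lemma le_of_forall_tilt {α β r q R E : ℝ} (hα : 0 < α) (hβ : 0 < β) (hr : 0 < r) (hr1 : r ≤ 1)
    (hq : 0 < q) (hq1 : q ≤ 1) (hR : 1 ≤ R)
    (h : ∀ l : ℝ, 0 ≤ l → l / 2 * E ≤ α * β * Real.exp l / R
      + 3 * (α * q * (1 + Real.log (R / (α * q)))) + 3 * (β * r * (1 + Real.log (R / (β * r))))) :
    E ≤ 6 * (α * β) + 24 * (α + β) * (√r + √q) := by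
  have hR0 : 0 < R := by linarith
  have hsr : 0 < √r := Real.sqrt_pos.mpr hr
  have hsq : 0 < √q := Real.sqrt_pos.mpr hq
  set l := max 1 (max (Real.log (R * √r / β)) (Real.log (R * √q / α))) with hl
  have hl1 : 1 ≤ l := le_max_left _ _
  have hlr : Real.log (R * √r / β) ≤ l := (le_max_left _ _).trans (le_max_right _ _)
  have hlq : Real.log (R * √q / α) ≤ l := (le_max_right _ _).trans (le_max_right _ _)
  have hexp : Real.exp l ≤ 3 + R * √r / β + R * √q / α := by
    have h1 : 0 < R * √r / β := by positivity
    have h2 : 0 < R * √q / α := by positivity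
    have h3 := Real.exp_one_lt_d9
    rcases max_choice 1 (max (Real.log (R * √r / β)) (Real.log (R * √q / α))) with h4 | h4
    · rw [hl, h4]; linarith
    · rcases max_choice (Real.log (R * √r / β)) (Real.log (R * √q / α)) with h5 | h5
      · rw [hl, h4, h5, Real.exp_log h1]; linarith
      · rw [hl, h4, h5, Real.exp_log h2]; linarith
  have h1 : α * β * Real.exp l / R ≤ l * (3 * (α * β) + α * √r + β * √q) := by
    calc α * β * Real.exp l / R ≤ α * β * (3 + R * √r / β + R * √q / α) / R := by gcongr
      _ = 3 * (α * β) / R + α * √r + β * √q := by field_simp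
      _ ≤ 3 * (α * β) + α * √r + β * √q := by
        gcongr; exact div_le_self (by positivity) hR
      _ ≤ _ := le_mul_of_one_le_left (by positivity) hl1
  have h2 := mul_one_add_log_le hα hq hq1 hR0 hl1 hlq
  have h3 := mul_one_add_log_le hβ hr hr1 hR0 hl1 hlr
  have h4 := h l (by linarith)
  have h5 : l * (E / 2) ≤ l * (3 * (α * β) + α * √r + β * √q + 12 * (α * √q) + 12 * (β * √r)) := by
    linarith
  have h6 := le_of_mul_le_mul_left h5 (by linarith)
  have h7 : 0 < α * √r := by positivity
  have h8 : 0 < β * √q := by positivity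
  linarith

/-- Edge count bound between two dyadic levels of sizes `s` and `t` and values `x` and `y`. -/
lemma level_pair_le {N D x y s t e : ℝ} (hN : 0 < N) (hD : 0 < D) (hx : 0 < x) (hy : 0 < y)
    (hs : 0 ≤ s) (ht : 0 ≤ t) (he : s = 0 ∨ t = 0 → e ≤ 0)
    (hxy : D ≤ x * y) (hxD : x ≤ D * y) (hyD : y ≤ D * x)
    (h : ∀ l : ℝ, 0 ≤ l → l / 2 * e ≤ D ^ 2 / N * s * t * Real.exp l
      + 3 * entropyBound N s + 3 * entropyBound N t) :
    x * y * e ≤ D * N * (6 * (s * x ^ 2 / N * (t * y ^ 2 / N)) +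
      24 * (s * x ^ 2 / N + t * y ^ 2 / N) * (√(x / (y * D)) + √(y / (x * D)))) := by
  by_cases h0 : s = 0 ∨ t = 0
  · calc x * y * e ≤ 0 := mul_nonpos_of_nonneg_of_nonpos (by positivity) (he h0)
      _ ≤ _ := by positivity
  push Not at h0
  have hs' : 0 < s := lt_of_le_of_ne hs h0.1.symm
  have ht' : 0 < t := lt_of_le_of_ne ht h0.2.symm
  rw [← div_le_iff₀' (by positivity)]
  refine le_of_forall_tilt (R := x * y / D) (by positivity) (by positivity) (by positivity)
    ?_ (by positivity) ?_ ?_ ?_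
  · rw [div_le_one (by positivity)]; linarith
  · rw [div_le_one (by positivity)]; linarith
  · rwa [one_le_div hD]
  · intro l hl
    have h1 := h l hl
    unfold entropyBound at h1
    have e1 : x * y / D / (s * x ^ 2 / N * (y / (x * D))) = N / s := by field_simp
    have e2 : x * y / D / (t * y ^ 2 / N * (x / (y * D))) = N / t := by field_simp
    rw [e1, e2]
    have h2 := mul_le_mul_of_nonneg_left h1 (show 0 ≤ x * y / (D * N) by positivity)
    generalize Real.log (N / s) = p at *
    generalize Real.log (N / t) = r at *
    calc _ = x * y / (D * N) * (l / 2 * e) := by ring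
      _ ≤ _ := h2
      _ = _ := by field_simp

lemma sum_sqrt_mul_two_pow_le {x : ℝ} (hx : 0 < x) (K : ℕ) :
    ∑ l ∈ range K, (if x * 2 ^ l ≤ 1 then √(x * 2 ^ l) else 0) ≤ 4 := by
  have key : ∑ l ∈ range K, (if x * 2 ^ l ≤ 1 then √(x * 2 ^ l) else 0) ≤ 4 ∧
      ∑ l ∈ range K, (if x * 2 ^ l ≤ 1 then √(x * 2 ^ l) else 0) ≤ 3 * √(x * 2 ^ K) := by
    induction K with
    | zero => simp
    | succ K ih =>
      rw [sum_range_succ]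
      have h1 : √(x * 2 ^ (K + 1)) = √(x * 2 ^ K) * √2 := by
        rw [← Real.sqrt_mul (by positivity)]; ring_nf
      have h2 : 4 / 3 ≤ √2 := Real.le_sqrt_of_sq_le (by norm_num)
      have h3 : 0 ≤ √(x * 2 ^ K) := Real.sqrt_nonneg _
      rw [h1]
      split_ifs with h
      · have h4 : √(x * 2 ^ K) ≤ 1 := Real.sqrt_le_iff.mpr ⟨zero_le_one, by simpa using h⟩
        constructor <;> nlinarith [ih.2]
      · constructor <;> nlinarith [ih.1, ih.2]
  exact key.1

lemma sum_sqrt_div_two_pow_le {x : ℝ} (hx : 0 < x) (K : ℕ) :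
    ∑ l ∈ range K, (if x / 2 ^ l ≤ 1 then √(x / 2 ^ l) else 0) ≤ 4 := by
  rw [← sum_range_reflect]
  refine le_trans (le_of_eq (sum_congr rfl fun l hl => ?_))
    (sum_sqrt_mul_two_pow_le (x := x / 2 ^ (K - 1)) (by positivity) K)
  have hl' := mem_range.mp hl
  have : x / 2 ^ (K - 1) * 2 ^ l = x / 2 ^ (K - 1 - l) := by
    rw [show K - 1 = (K - 1 - l) + l by omega, pow_add]
    rw [show K - 1 - l + l - l = K - 1 - l by omega]
    field_simp
  rw [this]

/-- Summing `level_pair_le` over all comparable pairs of dyadic levels. -/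
lemma sum_levels_le {N D : ℝ} (hN : 0 < N) (hD : 0 < D) (K : ℕ) (s t : ℕ → ℝ) (e : ℕ → ℕ → ℝ)
    (hs : ∀ k, 0 ≤ s k) (ht : ∀ k, 0 ≤ t k) (he : ∀ k l, s k = 0 ∨ t l = 0 → e k l ≤ 0)
    (hsN : ∑ k ∈ range K, s k * (2 ^ k) ^ 2 ≤ 4 * N)
    (htN : ∑ k ∈ range K, t k * (2 ^ k) ^ 2 ≤ 4 * N)
    (h : ∀ k l, ∀ u : ℝ, 0 ≤ u → u / 2 * e k l ≤ D ^ 2 / N * s k * t l * Real.exp u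
      + 3 * entropyBound N (s k) + 3 * entropyBound N (t l)) :
    ∑ k ∈ range K, ∑ l ∈ range K,
      (if D ≤ 2 ^ k * 2 ^ l ∧ (2 : ℝ) ^ k ≤ D * 2 ^ l ∧ (2 : ℝ) ^ l ≤ D * 2 ^ k then
        2 ^ k * 2 ^ l * e k l else 0) ≤ 1632 * (D * N) := by
  set α : ℕ → ℝ := fun k => s k * (2 ^ k) ^ 2 / N with hα
  set β : ℕ → ℝ := fun k => t k * (2 ^ k) ^ 2 / N with hβ
  have hα0 : ∀ k, 0 ≤ α k := fun k => by have := hs k; positivity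
  have hβ0 : ∀ k, 0 ≤ β k := fun k => by have := ht k; positivity
  have hαs : ∑ k ∈ range K, α k ≤ 4 := by
    rw [hα, ← sum_div, div_le_iff₀ hN]; exact hsN
  have hβs : ∑ k ∈ range K, β k ≤ 4 := by
    rw [hβ, ← sum_div, div_le_iff₀ hN]; exact htN
  set f : ℕ → ℕ → ℝ := fun k l => if 1 / (2 ^ k * D) * 2 ^ l ≤ 1 then √(1 / (2 ^ k * D) * 2 ^ l)
    else 0 with hf
  set g : ℕ → ℕ → ℝ := fun k l => if (2 ^ k / D) / 2 ^ l ≤ 1 then √((2 ^ k / D) / 2 ^ l)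
    else 0 with hg
  have hf0 : ∀ k l, 0 ≤ f k l := fun k l => by simp only [hf]; split_ifs <;> positivity
  have hg0 : ∀ k l, 0 ≤ g k l := fun k l => by simp only [hg]; split_ifs <;> positivity
  have hfs : ∀ k, ∑ l ∈ range K, f k l ≤ 4 := fun k => sum_sqrt_mul_two_pow_le (by positivity) K
  have hgs : ∀ k, ∑ l ∈ range K, g k l ≤ 4 := fun k => sum_sqrt_div_two_pow_le (by positivity) K
  have hpt : ∀ k l, (if D ≤ 2 ^ k * 2 ^ l ∧ (2 : ℝ) ^ k ≤ D * 2 ^ l ∧ (2 : ℝ) ^ l ≤ D * 2 ^ k then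
        2 ^ k * 2 ^ l * e k l else 0) ≤ D * N * (6 * (α k * β l) + 24 * (α k * f k l + α k * g k l
          + β l * f l k + β l * g l k)) := by
    intro k l
    split_ifs with hc
    · obtain ⟨h1, h2, h3⟩ := hc
      refine (level_pair_le hN hD (by positivity) (by positivity) (hs k) (ht l) (he k l) h1 h2 h3
        (h k l)).trans (le_of_eq ?_)
      have e1 : f k l = √(2 ^ l / (2 ^ k * D)) := by
        have : 1 / (2 ^ k * D) * 2 ^ l = 2 ^ l / (2 ^ k * D) := by ring
        simp only [hf, this]
        rw [if_pos]; rw [div_le_one (by positivity)]; linarith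
      have e2 : g k l = √(2 ^ k / (2 ^ l * D)) := by
        have : (2 ^ k / D) / 2 ^ l = 2 ^ k / (2 ^ l * D) := by field_simp
        simp only [hg, this]
        rw [if_pos]; rw [div_le_one (by positivity)]; linarith
      have e3 : f l k = √(2 ^ k / (2 ^ l * D)) := by
        have : 1 / (2 ^ l * D) * 2 ^ k = 2 ^ k / (2 ^ l * D) := by ring
        simp only [hf, this]
        rw [if_pos]; rw [div_le_one (by positivity)]; linarith
      have e4 : g l k = √(2 ^ l / (2 ^ k * D)) := by
        have : (2 ^ l / D) / 2 ^ k = 2 ^ l / (2 ^ k * D) := by field_simp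
        simp only [hg, this]
        rw [if_pos]; rw [div_le_one (by positivity)]; linarith
      rw [e1, e2, e3, e4]; simp only [hα, hβ]; ring
    · have h1 := hα0 k
      have h2 := hβ0 l
      have h3 := hf0 k l
      have h4 := hg0 k l
      have h5 := hf0 l k
      have h6 := hg0 l k
      positivity
  refine (sum_le_sum fun k _ => sum_le_sum fun l _ => hpt k l).trans ?_
  have hcol : ∀ (γ : ℕ → ℝ) (φ : ℕ → ℕ → ℝ), (∀ k, 0 ≤ γ k) → ∑ k ∈ range K, γ k ≤ 4 →
      (∀ k, ∑ l ∈ range K, φ k l ≤ 4) → ∑ k ∈ range K, ∑ l ∈ range K, γ k * φ k l ≤ 16 := by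
    intro γ φ h1 h2 h3
    simp_rw [← mul_sum]
    calc ∑ k ∈ range K, γ k * ∑ l ∈ range K, φ k l ≤ ∑ k ∈ range K, γ k * 4 :=
          sum_le_sum fun k _ => mul_le_mul_of_nonneg_left (h3 k) (h1 k)
      _ ≤ 16 := by rw [← sum_mul]; linarith
  have b0 := hcol α (fun _ l => β l) hα0 hαs (fun _ => hβs)
  have b1 := hcol α f hα0 hαs hfs
  have b2 := hcol α g hα0 hαs hgs
  have b3 := hcol β f hβ0 hβs hfs
  have b4 := hcol β g hβ0 hβs hgs
  rw [sum_comm] at b3 b4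
  simp_rw [← mul_sum, sum_add_distrib, ← mul_sum, sum_add_distrib]
  simp_rw [← mul_sum] at b0
  have : 0 < D * N := by positivity
  rw [mul_comm 1632]
  gcongr
  linarith

/-- The coordinates of an integer vector whose absolute value lies in `[2 ^ k, 2 ^ (k + 1))`. -/
def dyadicLevel {N : ℕ} (z : Fin N → ℤ) (k : ℕ) : Finset (Fin N) :=
  univ.filter fun i => z i ≠ 0 ∧ Nat.log 2 (z i).natAbs = k

lemma two_pow_log_natAbs_le {m : ℤ} (hm : m ≠ 0) :
    (2 : ℝ) ^ Nat.log 2 m.natAbs ≤ |(m : ℝ)| := by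
  have h := Nat.pow_log_le_self 2 (Int.natAbs_ne_zero.mpr hm)
  rw [← Int.cast_abs, ← Nat.cast_natAbs]
  exact_mod_cast h

lemma abs_lt_two_mul_two_pow_log (m : ℤ) :
    |(m : ℝ)| < 2 * 2 ^ Nat.log 2 m.natAbs := by
  have h := Nat.lt_pow_succ_log_self one_lt_two m.natAbs
  rw [← Int.cast_abs, ← Nat.cast_natAbs, ← pow_succ']
  exact_mod_cast h

lemma log_natAbs_lt {N : ℕ} {z : Fin N → ℤ} (hz : z ∈ intVecs N) (i : Fin N) :
    Nat.log 2 (z i).natAbs < 4 * N + 1 := by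
  have h1 := mem_intVecs.mp hz
  have h2 : z i ^ 2 ≤ ∑ i, z i ^ 2 := single_le_sum (fun i _ => sq_nonneg (z i)) (mem_univ i)
  have h3 := Int.abs_le_sq (z i)
  have h4 := Nat.log_le_self 2 (z i).natAbs
  have h5 := Int.natCast_natAbs (z i)
  omega

lemma sum_card_dyadicLevel_le {N : ℕ} {z : Fin N → ℤ} (hz : z ∈ intVecs N) (K : ℕ) :
    ∑ k ∈ range K, ((dyadicLevel z k).card : ℝ) * (2 ^ k) ^ 2 ≤ 4 * (N : ℝ) := by
  refine le_trans ?_ (sum_sq_of_mem_intVecs hz)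
  simp_rw [dyadicLevel, card_filter, Nat.cast_sum, sum_mul]
  rw [sum_comm]
  refine sum_le_sum fun i _ => ?_
  by_cases hi : z i = 0
  · simp [hi]
  have h1 := two_pow_log_natAbs_le hi
  simp only [ne_eq, hi, not_false_eq_true, true_and, Nat.cast_ite, Nat.cast_one,
    CharP.cast_eq_zero, ite_mul, one_mul, zero_mul, sum_ite_eq]
  split_ifs
  · rw [← sq_abs (z i : ℝ)]; gcongr
  · positivity

lemma heavy_le {N : ℕ} {D : ℝ} (hD : 0 < D) {z w : Fin N → ℤ} (hz : z ∈ intVecs N)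
    (hw : w ∈ intVecs N) (i j : Fin N) :
    (if 4 * D < |(z i : ℝ) * w j| then |(z i : ℝ) * w j| else 0) ≤
      2 / D * (z i : ℝ) ^ 2 + 2 / D * (w j : ℝ) ^ 2 +
      ∑ k ∈ range (4 * N + 1), ∑ l ∈ range (4 * N + 1),
        (if D ≤ 2 ^ k * 2 ^ l ∧ (2 : ℝ) ^ k ≤ D * 2 ^ l ∧ (2 : ℝ) ^ l ≤ D * 2 ^ k then
          4 * (2 ^ k * 2 ^ l * (if i ∈ dyadicLevel z k ∧ j ∈ dyadicLevel w l then 1 else 0))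
          else 0) := by
  have h0 : ∀ k l : ℕ, (0 : ℝ) ≤
        (if D ≤ 2 ^ k * 2 ^ l ∧ (2 : ℝ) ^ k ≤ D * 2 ^ l ∧ (2 : ℝ) ^ l ≤ D * 2 ^ k then
          4 * (2 ^ k * 2 ^ l * (if i ∈ dyadicLevel z k ∧ j ∈ dyadicLevel w l then 1 else 0))
          else 0) := fun k l => by split_ifs <;> positivity
  set F : ℕ → ℕ → ℝ := fun k l =>
        (if D ≤ 2 ^ k * 2 ^ l ∧ (2 : ℝ) ^ k ≤ D * 2 ^ l ∧ (2 : ℝ) ^ l ≤ D * 2 ^ k then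
          4 * (2 ^ k * 2 ^ l * (if i ∈ dyadicLevel z k ∧ j ∈ dyadicLevel w l then 1 else 0))
          else 0) with hF
  have hS : 0 ≤ ∑ k ∈ range (4 * N + 1), ∑ l ∈ range (4 * N + 1), F k l :=
    sum_nonneg fun k _ => sum_nonneg fun l _ => h0 k l
  have hz2 : 0 ≤ 2 / D * (z i : ℝ) ^ 2 := by positivity
  have hw2 : 0 ≤ 2 / D * (w j : ℝ) ^ 2 := by positivity
  split_ifs with h
  swap
  · positivity
  have hzi : z i ≠ 0 := by
    intro h'; simp [h'] at h; linarith
  have hwj : w j ≠ 0 := by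
    intro h'; simp [h'] at h; linarith
  have z1 := two_pow_log_natAbs_le hzi
  have w1 := two_pow_log_natAbs_le hwj
  have z2 := abs_lt_two_mul_two_pow_log (z i)
  have w2 := abs_lt_two_mul_two_pow_log (w j)
  rw [abs_mul] at h ⊢
  rw [← sq_abs (z i : ℝ), ← sq_abs (w j : ℝ)] at *
  set k := Nat.log 2 (z i).natAbs with hk
  set l := Nat.log 2 (w j).natAbs with hl
  set x := |(z i : ℝ)|
  set y := |(w j : ℝ)|
  have hp : (0 : ℝ) < 2 ^ k := by positivity
  have hq : (0 : ℝ) < 2 ^ l := by positivity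
  have hxy : x * y ≤ 4 * (2 ^ k * 2 ^ l) := by nlinarith
  by_cases c1 : (2 : ℝ) ^ k ≤ D * 2 ^ l
  swap
  · have h1 : D * y ≤ 2 * x := by nlinarith
    have h2 : x * y ≤ 2 / D * x ^ 2 := by
      rw [div_mul_eq_mul_div, le_div_iff₀ hD]; nlinarith
    linarith
  by_cases c2 : (2 : ℝ) ^ l ≤ D * 2 ^ k
  swap
  · have h1 : D * x ≤ 2 * y := by nlinarith
    have h2 : x * y ≤ 2 / D * y ^ 2 := by
      rw [div_mul_eq_mul_div, le_div_iff₀ hD]; nlinarith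
    linarith
  have h3 : F k l ≤ ∑ k ∈ range (4 * N + 1), ∑ l ∈ range (4 * N + 1), F k l :=
    (single_le_sum (f := fun l => F k l) (fun l _ => h0 k l)
      (mem_range.mpr (log_natAbs_lt hw j))).trans
    (single_le_sum (f := fun k => ∑ l ∈ range (4 * N + 1), F k l)
      (fun k _ => sum_nonneg fun l _ => h0 k l) (mem_range.mpr (log_natAbs_lt hz i)))
  have h4 : F k l = 4 * (2 ^ k * 2 ^ l) := by
    have c3 : D ≤ 2 ^ k * 2 ^ l := by linarith
    simp only [hF]
    rw [if_pos ⟨c3, c1, c2⟩, if_pos, mul_one]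
    simp [dyadicLevel, hzi, hwj, ← hk, ← hl]
  linarith

/-- Large entries contribute little to the bilinear form of the adjacency matrix on vectors
supported on low-degree vertices. -/
lemma sum_heavy_le {n : ℕ} (hn : 0 < n) {D : ℝ} (hD : 0 < D) {ω : Config (2 * n)}
    (hE : EdgeDiscrepancy n (D ^ 2) ω) {z w : Fin (2 * n) → ℤ} (hz : z ∈ intVecs (2 * n))
    (hw : w ∈ intVecs (2 * n)) (hzd : ∀ i, z i ≠ 0 → ∑ j, adjMat ω i j ≤ 20 * D ^ 2)
    (hwd : ∀ i, w i ≠ 0 → ∑ j, adjMat ω i j ≤ 20 * D ^ 2) :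
    ∑ i, ∑ j, adjMat ω i j * (if 4 * D < |(z i : ℝ) * w j| then |(z i : ℝ) * w j| else 0)
      ≤ 14400 * (D * n) := by
  have row : ∀ x ∈ intVecs (2 * n), (∀ i, x i ≠ 0 → ∑ j, adjMat ω i j ≤ 20 * D ^ 2) →
      ∑ i, ∑ j, adjMat ω i j * (2 / D * (x i : ℝ) ^ 2) ≤ 320 * (D * n) := by
    intro x hx hxd
    simp_rw [← sum_mul]
    have h1 : ∀ i, (∑ j, adjMat ω i j) * (2 / D * (x i : ℝ) ^ 2) ≤ 40 * D * (x i : ℝ) ^ 2 := by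
      intro i
      by_cases hi : x i = 0
      · simp [hi]
      · calc _ ≤ 20 * D ^ 2 * (2 / D * (x i : ℝ) ^ 2) := by
              gcongr; exact hxd i hi
          _ = _ := by field_simp; norm_num
    refine (sum_le_sum fun i _ => h1 i).trans ?_
    rw [← mul_sum]
    have h2 := sum_sq_of_mem_intVecs hx
    push_cast at h2
    calc _ ≤ 40 * D * (4 * (2 * n)) := by gcongr
      _ = _ := by ring
  have lev := sum_levels_le (N := 2 * n) (D := D) (by positivity) hD (4 * (2 * n) + 1)
    (fun k => ((dyadicLevel z k).card : ℝ)) (fun k => ((dyadicLevel w k).card : ℝ))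
    (fun k l => eCountC ω (dyadicLevel z k) (dyadicLevel w l))
    (fun _ => by positivity) (fun _ => by positivity)
    (fun k l h => by
      simp only [Nat.cast_eq_zero, card_eq_zero] at h
      rcases h with h | h <;> simp [eCountC, h])
    (by exact_mod_cast sum_card_dyadicLevel_le hz _)
    (by exact_mod_cast sum_card_dyadicLevel_le hw _)
    (fun k l u hu => hE _ _ u hu)
  have hsum : ∑ i, ∑ j, adjMat ω i j * ∑ k ∈ range (4 * (2 * n) + 1),
      ∑ l ∈ range (4 * (2 * n) + 1),
        (if D ≤ 2 ^ k * 2 ^ l ∧ (2 : ℝ) ^ k ≤ D * 2 ^ l ∧ (2 : ℝ) ^ l ≤ D * 2 ^ k then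
          4 * (2 ^ k * 2 ^ l * (if i ∈ dyadicLevel z k ∧ j ∈ dyadicLevel w l then 1 else 0))
          else 0) = 4 * ∑ k ∈ range (4 * (2 * n) + 1), ∑ l ∈ range (4 * (2 * n) + 1),
        (if D ≤ 2 ^ k * 2 ^ l ∧ (2 : ℝ) ^ k ≤ D * 2 ^ l ∧ (2 : ℝ) ^ l ≤ D * 2 ^ k then
          2 ^ k * 2 ^ l * eCountC ω (dyadicLevel z k) (dyadicLevel w l) else 0) := by
    simp_rw [mul_sum]
    simp_rw [sum_comm (s := (univ : Finset (Fin (2 * n)))) (t := range (4 * (2 * n) + 1))]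
    refine sum_congr rfl fun k _ => sum_congr rfl fun l _ => ?_
    split_ifs with h
    · rw [eCountC_eq_sum]
      simp_rw [mul_sum]
      exact sum_congr rfl fun i _ => sum_congr rfl fun j _ => by ring
    · simp
  calc _ ≤ ∑ i, ∑ j, adjMat ω i j * _ := sum_le_sum fun i _ => sum_le_sum fun j _ =>
        mul_le_mul_of_nonneg_left (heavy_le hD hz hw i j) (adjMat_nonneg ω i j)
    _ = ∑ i, ∑ j, adjMat ω i j * (2 / D * (z i : ℝ) ^ 2) +
        ∑ i, ∑ j, adjMat ω i j * (2 / D * (w i : ℝ) ^ 2) + _ := by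
      simp_rw [mul_add, sum_add_distrib]
      rw [hsum]
      congr 2
      rw [sum_comm]
      exact sum_congr rfl fun i _ => sum_congr rfl fun j _ => by rw [adjMat_symm]
    _ ≤ 320 * (D * n) + 320 * (D * n) + 4 * (1632 * (D * (2 * n))) := by
      gcongr
      · exact row z hz hzd
      · exact row w hw hwd
    _ ≤ _ := by
      have : 0 < D * n := by positivity
      linarith

/-- The truncated bilinear form of the centered adjacency matrix is small on all pairs of
integer vectors. -/
def LightBound (n : ℕ) (a b : ℝ) (ω : Config (2 * n)) : Prop :=
  ∀ z ∈ intVecs (2 * n), ∀ w ∈ intVecs (2 * n),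
    ∑ i, ∑ j, (adjMat ω i j - expAdj n a b i j) * lightProd (4 * √(a + b)) z w i j
      ≤ 160 * √(a + b) * n

lemma sum_centered_int_le {n : ℕ} (hn : 0 < n) {a b : ℝ} (hb : 0 < b) (hba : b ≤ a)
    {ω : Config (2 * n)} (hL : LightBound n a b ω) (hE : EdgeDiscrepancy n (a + b) ω)
    {z w : Fin (2 * n) → ℤ} (hz : z ∈ intVecs (2 * n)) (hw : w ∈ intVecs (2 * n))
    (hzd : ∀ i, z i ≠ 0 → ∑ j, adjMat ω i j ≤ 20 * (a + b))
    (hwd : ∀ i, w i ≠ 0 → ∑ j, adjMat ω i j ≤ 20 * (a + b)) :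
    ∑ i, ∑ j, (adjMat ω i j - expAdj n a b i j) * (z i * w j) ≤ 14600 * (√(a + b) * n) := by
  have hd : 0 < a + b := by linarith
  have hn' : (0 : ℝ) < n := by exact_mod_cast hn
  set D := √(a + b) with hDdef
  have hD : 0 < D := Real.sqrt_pos.mpr hd
  have hDD : a + b = D ^ 2 := (Real.sq_sqrt hd.le).symm
  rw [hDD] at hE hzd hwd
  have h1 := hL z hz w hw
  rw [← hDdef] at h1
  have h2 := sum_heavy_le hn hD hE hz hw hzd hwd
  have h3 : ∑ i, ∑ j, D / (4 * n) * ((z i : ℝ) ^ 2 * (w j : ℝ) ^ 2) ≤ 16 * (D * n) := by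
    simp_rw [← mul_sum]
    have := sum_mul_sq_le hz hw
    push_cast at this
    simp_rw [← mul_sum] at this
    calc _ ≤ D / (4 * n) * (16 * (2 * n) ^ 2) := by gcongr
      _ = _ := by field_simp; norm_num
  have hpt : ∀ i j, (adjMat ω i j - expAdj n a b i j) * ((z i : ℝ) * w j) ≤
      (adjMat ω i j - expAdj n a b i j) * lightProd (4 * D) z w i j +
      adjMat ω i j * (if 4 * D < |(z i : ℝ) * w j| then |(z i : ℝ) * w j| else 0) +
      D / (4 * n) * ((z i : ℝ) ^ 2 * (w j : ℝ) ^ 2) := by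
    intro i j
    have e0 := expAdj_nonneg (n := n) hb.le hba i j
    have e1 := expAdj_le (n := n) hb.le hba i j
    have a0 := adjMat_nonneg ω i j
    unfold lightProd
    rw [← mul_pow, ← sq_abs ((z i : ℝ) * w j)]
    by_cases h : |(z i : ℝ) * w j| ≤ 4 * D
    · rw [if_pos h, if_neg (not_lt.mpr h)]
      have : 0 ≤ D / (4 * n) * |(z i : ℝ) * w j| ^ 2 := by positivity
      linarith
    · rw [if_neg h, if_pos (not_le.mp h)]
      push Not at h
      have h4 := le_abs_self ((z i : ℝ) * w j)
      have h5 := neg_abs_le ((z i : ℝ) * w j)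
      set p := (z i : ℝ) * w j
      have h6 : expAdj n a b i j * |p| ≤ D / (4 * n) * |p| ^ 2 := by
        calc _ ≤ (a + b) / n * |p| := by gcongr
          _ = D / (4 * n) * (|p| * (4 * D)) := by rw [hDD]; field_simp
          _ ≤ D / (4 * n) * (|p| * |p|) := by gcongr
          _ = _ := by ring
      nlinarith
  refine (sum_le_sum fun i _ => sum_le_sum fun j _ => hpt i j).trans ?_
  simp_rw [sum_add_distrib]
  have : 0 < D * n := by positivity
  linarith

/-- Rounding a real vector to an integer vector without decreasing a linear functional. -/
lemma exists_int_round {N : ℕ} (c y : Fin N → ℝ) (hy : ∑ i, y i ^ 2 ≤ N) :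
    ∃ Y ∈ intVecs N, (∀ i, y i = 0 → Y i = 0) ∧ ∑ i, c i * y i ≤ ∑ i, c i * (Y i : ℝ) := by
  set Y : Fin N → ℤ := fun i => if 0 ≤ c i then ⌈y i⌉ else ⌊y i⌋ with hY
  refine ⟨Y, ?_, fun i hi => by simp [hY, hi], sum_le_sum fun i _ => ?_⟩
  · rw [mem_intVecs]
    have h : ∀ i, (Y i : ℝ) ^ 2 ≤ 2 * y i ^ 2 + 2 := by
      intro i
      have : |(Y i : ℝ) - y i| ≤ 1 := by
        simp only [hY]
        rw [abs_le]
        split_ifs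
        · constructor <;> linarith [Int.le_ceil (y i), Int.ceil_lt_add_one (y i)]
        · constructor <;> linarith [Int.floor_le (y i), Int.lt_floor_add_one (y i)]
      rw [abs_le] at this
      nlinarith [sq_nonneg (2 * y i - Y i)]
    have h2 : ∑ i, (Y i : ℝ) ^ 2 ≤ 4 * N := by
      refine (sum_le_sum fun i _ => h i).trans ?_
      rw [sum_add_distrib, ← mul_sum]
      simp only [sum_const, card_univ, Fintype.card_fin, nsmul_eq_mul]
      linarith
    exact_mod_cast h2
  · simp only [hY]
    split_ifs with h
    · exact mul_le_mul_of_nonneg_left (Int.le_ceil _) h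
    · exact mul_le_mul_of_nonpos_left (Int.floor_le _) (not_le.mp h).le

lemma sum_centered_real_le {n : ℕ} (hn : 0 < n) {a b : ℝ} (hb : 0 < b) (hba : b ≤ a)
    {ω : Config (2 * n)} (hL : LightBound n a b ω) (hE : EdgeDiscrepancy n (a + b) ω)
    {x y : Fin (2 * n) → ℝ} (hx : ∑ i, x i ^ 2 ≤ 2 * n) (hy : ∑ i, y i ^ 2 ≤ 2 * n)
    (hxd : ∀ i, x i ≠ 0 → ∑ j, adjMat ω i j ≤ 20 * (a + b))
    (hyd : ∀ i, y i ≠ 0 → ∑ j, adjMat ω i j ≤ 20 * (a + b)) :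
    ∑ i, ∑ j, (adjMat ω i j - expAdj n a b i j) * (x i * y j) ≤ 14600 * (√(a + b) * n) := by
  set M := fun i j => adjMat ω i j - expAdj n a b i j with hM
  obtain ⟨X, hX, hX0, hX1⟩ := exists_int_round (fun i => ∑ j, M i j * y j) x (by exact_mod_cast hx)
  obtain ⟨Y, hY, hY0, hY1⟩ := exists_int_round (fun j => ∑ i, M i j * X i) y (by exact_mod_cast hy)
  refine le_trans ?_ (sum_centered_int_le hn hb hba hL hE hX hY
    (fun i hi => hxd i fun h => hi (hX0 i h)) (fun i hi => hyd i fun h => hi (hY0 i h)))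
  calc ∑ i, ∑ j, M i j * (x i * y j) = ∑ i, (∑ j, M i j * y j) * x i := by
        simp_rw [sum_mul]
        exact sum_congr rfl fun i _ => sum_congr rfl fun j _ => by ring
    _ ≤ _ := hX1
    _ = ∑ j, (∑ i, M i j * X i) * y j := by
        simp_rw [sum_mul]
        rw [sum_comm]
        exact sum_congr rfl fun i _ => sum_congr rfl fun j _ => by ring
    _ ≤ _ := hY1
    _ = _ := by
        simp_rw [sum_mul]
        rw [sum_comm]
        exact sum_congr rfl fun i _ => sum_congr rfl fun j _ => by ring

lemma abs_sum_centered_le {n : ℕ} (hn : 0 < n) {a b : ℝ} (hb : 0 < b) (hba : b ≤ a)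
    {ω : Config (2 * n)} (hL : LightBound n a b ω) (hE : EdgeDiscrepancy n (a + b) ω)
    {x : Fin (2 * n) → ℝ} (hxd : ∀ i, x i ≠ 0 → ∑ j, adjMat ω i j ≤ 20 * (a + b)) :
    |∑ i, ∑ j, (adjMat ω i j - expAdj n a b i j) * (x i * x j)|
      ≤ 7300 * √(a + b) * ∑ i, x i ^ 2 := by
  have hn' : (0 : ℝ) < n := by exact_mod_cast hn
  rcases (sum_nonneg fun i (_ : i ∈ univ) => sq_nonneg (x i)).eq_or_lt with h0 | h0
  · have hx : ∀ i, x i = 0 := fun i => by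
      have := (sum_eq_zero_iff_of_nonneg fun i _ => sq_nonneg (x i)).mp h0.symm i (mem_univ i)
      simpa using this
    simp [hx]
  set q := ∑ i, x i ^ 2 with hq
  set s := √(2 * n / q) with hs
  have hs0 : 0 < s := Real.sqrt_pos.mpr (by positivity)
  have hs2 : s ^ 2 = 2 * n / q := Real.sq_sqrt (by positivity)
  have hsx : ∑ i, (s * x i) ^ 2 ≤ 2 * n := by
    simp_rw [mul_pow]
    rw [← mul_sum, hs2, ← hq]
    exact (div_mul_cancel₀ _ h0.ne').le
  have hsd : ∀ i, s * x i ≠ 0 → ∑ j, adjMat ω i j ≤ 20 * (a + b) :=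
    fun i hi => hxd i (right_ne_zero_of_mul hi)
  have h1 := sum_centered_real_le hn hb hba hL hE hsx hsx hsd hsd
  have h2 := sum_centered_real_le (y := fun i => -(s * x i)) hn hb hba hL hE hsx
    (by simpa using hsx) hsd (fun i hi => hsd i (by simpa using hi))
  have e1 : ∑ i, ∑ j, (adjMat ω i j - expAdj n a b i j) * (s * x i * (s * x j)) =
      s ^ 2 * ∑ i, ∑ j, (adjMat ω i j - expAdj n a b i j) * (x i * x j) := by
    simp_rw [mul_sum]
    exact sum_congr rfl fun i _ => sum_congr rfl fun j _ => by ring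
  simp only [mul_neg, sum_neg_distrib] at h2
  rw [e1] at h1 h2
  have h3 : s ^ 2 * |∑ i, ∑ j, (adjMat ω i j - expAdj n a b i j) * (x i * x j)|
      ≤ s ^ 2 * (7300 * √(a + b) * q) := by
    have e2 : s ^ 2 * (7300 * √(a + b) * q) = 14600 * (√(a + b) * n) := by
      rw [hs2]; field_simp; ring
    rw [e2]
    nth_rewrite 1 [← abs_of_pos (pow_pos hs0 2)]
    rw [← abs_mul, abs_le]
    constructor <;> linarith
  exact le_of_mul_le_mul_left h3 (by positivity)

/-- The sign vector of the two blocks. -/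
def blockSign (n : ℕ) (i : Fin (2 * n)) : ℝ := if (i : ℕ) < n then 1 else -1

lemma blockSign_sq (n : ℕ) (i : Fin (2 * n)) : blockSign n i ^ 2 = 1 := by
  unfold blockSign; split_ifs <;> norm_num

lemma expAdj_eq {n : ℕ} (hn : 0 < n) (a b : ℝ) (i j : Fin (2 * n)) :
    expAdj n a b i j = (a + b) / (2 * n) + (a - b) / (2 * n) * (blockSign n i * blockSign n j)
      - (if i = j then a / n else 0) := by
  have hn' : (0 : ℝ) < n := by exact_mod_cast hn
  unfold expAdj blockSign
  by_cases hij : i = j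
  · subst hij
    by_cases hi : (i : ℕ) < n <;> simp [hi] <;> field_simp <;> ring
  · by_cases hi : (i : ℕ) < n <;> by_cases hj : (j : ℕ) < n <;> simp [hij, hi, hj] <;>
      field_simp <;> ring

lemma sum_expAdj_mul {n : ℕ} (hn : 0 < n) (a b : ℝ) (x : Fin (2 * n) → ℝ) :
    ∑ i, ∑ j, expAdj n a b i j * (x i * x j) = (a + b) / (2 * n) * (∑ i, x i) ^ 2 +
      (a - b) / (2 * n) * (∑ i, blockSign n i * x i) ^ 2 - a / n * ∑ i, x i ^ 2 := by
  simp_rw [expAdj_eq hn, sub_mul, add_mul, sum_sub_distrib, sum_add_distrib]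
  congr 1
  · congr 1
    · rw [sq, sum_mul_sum, mul_sum]
      simp_rw [mul_sum]
    · rw [sq, sum_mul_sum, mul_sum]
      simp_rw [mul_sum]
      exact sum_congr rfl fun i _ => sum_congr rfl fun j _ => by ring
  · simp only [ite_mul, zero_mul, sum_ite_eq, mem_univ, if_true]
    rw [mul_sum]
    exact sum_congr rfl fun i _ => by ring

lemma degOf_eq_sum {N : ℕ} (ω : Config N) (i : Fin N) : (degOf ω i : ℝ) = ∑ j, adjMat ω i j := by
  unfold degOf adjMat
  rw [card_filter]
  push_cast
  rfl

lemma card_highDeg_le {n : ℕ} (hn : 0 < n) {d : ℝ} (hd : 0 < d) {ω : Config (2 * n)}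
    (hE : EdgeDiscrepancy n d ω) :
    ((univ.filter fun i => 20 * d < (degOf ω i : ℝ)).card : ℝ) ≤ 2 * n / d := by
  have hn' : (0 : ℝ) < n := by exact_mod_cast hn
  set S := univ.filter fun i => 20 * d < (degOf ω i : ℝ) with hS
  have h := hE S univ 1 zero_le_one
  have h1 : 20 * d * S.card ≤ eCountC ω S univ := by
    calc 20 * d * S.card = ∑ i ∈ S, 20 * d := by rw [sum_const, nsmul_eq_mul]; ring
      _ ≤ ∑ i ∈ S, (degOf ω i : ℝ) := sum_le_sum fun i hi => (mem_filter.mp hi).2.le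
      _ = _ := sum_congr rfl fun i _ => degOf_eq_sum ω i
  have h2 : entropyBound (2 * n) S.card ≤ 2 * n := entropyBound_le (by positivity) (by positivity)
  have h3 : entropyBound (2 * n) (univ : Finset (Fin (2 * n))).card ≤ 2 * n :=
    entropyBound_le (by positivity) (by positivity)
  have h4 := Real.exp_one_lt_d9
  have h5 : d / (2 * n) * S.card * (univ : Finset (Fin (2 * n))).card * Real.exp 1
      ≤ d * S.card * 3 := by
    rw [card_univ, Fintype.card_fin]
    push_cast
    calc _ = d * S.card * Real.exp 1 := by field_simp
      _ ≤ _ := by gcongr; linarith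
  rw [le_div_iff₀ hd]
  nlinarith

/-- Deleting few coordinates barely changes the square of a signed sum. -/
lemma abs_sq_sum_sub_sq_sum_le {N : ℕ} {d : ℝ} (hd : 0 < d) {S : Finset (Fin N)}
    (hS : (S.card : ℝ) ≤ N / d) {χ : Fin N → ℝ} (hχ : ∀ i, χ i ^ 2 = 1) (x : Fin N → ℝ) :
    |(∑ i, χ i * x i) ^ 2 - (∑ i, χ i * (if i ∈ S then 0 else x i)) ^ 2|
      ≤ 2 * N / √d * ∑ i, x i ^ 2 := by
  set X := ∑ i, x i ^ 2 with hX
  have hX0 : 0 ≤ X := sum_nonneg fun i _ => sq_nonneg _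
  set p := ∑ i, χ i * x i with hp
  set q := ∑ i, χ i * (if i ∈ S then 0 else x i) with hq
  have hr : p - q = ∑ i ∈ S, χ i * x i := by
    calc p - q = ∑ i, if i ∈ S then χ i * x i else 0 := by
          rw [hp, hq, ← sum_sub_distrib]
          exact sum_congr rfl fun i _ => by split_ifs <;> simp
      _ = _ := by rw [sum_ite_mem, univ_inter]
  have cs : ∀ (T : Finset (Fin N)) (f : Fin N → ℝ), (∀ i, f i ^ 2 ≤ x i ^ 2) →
      (∑ i ∈ T, χ i * f i) ^ 2 ≤ T.card * X := by
    intro T f hf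
    refine (sq_sum_le_card_mul_sum_sq).trans ?_
    gcongr
    calc ∑ i ∈ T, (χ i * f i) ^ 2 ≤ ∑ i ∈ T, x i ^ 2 := sum_le_sum fun i _ => by
          rw [mul_pow, hχ, one_mul]; exact hf i
      _ ≤ X := sum_le_sum_of_subset_of_nonneg (subset_univ _) fun i _ _ => sq_nonneg _
  have h1 : (p - q) ^ 2 ≤ N / d * X := by
    rw [hr]
    refine (cs S x fun _ => le_rfl).trans ?_
    gcongr
  have h2 : p ^ 2 ≤ N * X := by simpa using cs univ x fun _ => le_rfl
  have h3 : q ^ 2 ≤ N * X := by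
    refine (cs univ (fun i => if i ∈ S then 0 else x i) fun i => ?_).trans (by simp)
    split_ifs
    · simpa using sq_nonneg (x i)
    · exact le_rfl
  refine abs_le_of_sq_le_sq ?_ (by positivity)
  calc (p ^ 2 - q ^ 2) ^ 2 = (p - q) ^ 2 * (p + q) ^ 2 := by ring
    _ ≤ (N / d * X) * (4 * (N * X)) := by
      gcongr
      nlinarith [sq_nonneg (p - q)]
    _ = _ := by
      have : √d ^ 2 = d := Real.sq_sqrt hd.le
      rw [mul_pow, div_pow, this]; ring

/-- The quadratic form of the trimmed adjacency matrix is close to that of its rank-two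
expectation. -/
lemma abs_zeroOut_sub_le {n : ℕ} {a b : ℝ} (hb : 1 ≤ b) (hba : b ≤ a) (hn : a ≤ n)
    {ω : Config (2 * n)} (hL : LightBound n a b ω) (hE : EdgeDiscrepancy n (a + b) ω)
    (x : Fin (2 * n) → ℝ) :
    |∑ i, ∑ j, zeroOutHighDeg (a + b) ω (adjMat ω) i j * (x i * x j) -
      ((a + b) / (2 * n) * (∑ i, x i) ^ 2 + (a - b) / (2 * n) * (∑ i, blockSign n i * x i) ^ 2)|
      ≤ 7305 * √(a + b) * ∑ i, x i ^ 2 := by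
  have hn' : (0 : ℝ) < n := by linarith
  have hn0 : 0 < n := by exact_mod_cast hn'
  have hd : 0 < a + b := by linarith
  set S := univ.filter fun i => 20 * (a + b) < (degOf ω i : ℝ) with hS
  have hSc : (S.card : ℝ) ≤ (2 * n : ℕ) / (a + b) := by
    push_cast; exact card_highDeg_le hn0 hd hE
  set y : Fin (2 * n) → ℝ := fun i => if i ∈ S then 0 else x i with hy
  have hyd : ∀ i, y i ≠ 0 → ∑ j, adjMat ω i j ≤ 20 * (a + b) := by
    intro i hi
    rw [← degOf_eq_sum]
    by_contra h
    push Not at h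
    exact hi (by simp [hy, hS, h])
  have e1 : ∑ i, ∑ j, zeroOutHighDeg (a + b) ω (adjMat ω) i j * (x i * x j) =
      ∑ i, ∑ j, adjMat ω i j * (y i * y j) := by
    refine sum_congr rfl fun i _ => sum_congr rfl fun j _ => ?_
    unfold zeroOutHighDeg
    by_cases hi : 20 * (a + b) < (degOf ω i : ℝ) <;> by_cases hj : 20 * (a + b) < (degOf ω j : ℝ)
      <;> simp [hy, hS, hi, hj]
  have c1 := abs_sum_centered_le hn0 (by linarith) hba hL hE hyd
  simp_rw [sub_mul, sum_sub_distrib] at c1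
  rw [sum_expAdj_mul hn0] at c1
  have c2 := abs_sq_sum_sub_sq_sum_le hd hSc (χ := fun _ => 1) (fun _ => by norm_num) x
  have c3 := abs_sq_sum_sub_sq_sum_le hd hSc (blockSign_sq n) x
  simp only [one_mul] at c2
  have hX : ∑ i, y i ^ 2 ≤ ∑ i, x i ^ 2 := sum_le_sum fun i _ => by
    simp only [hy]; split_ifs
    · simpa using sq_nonneg (x i)
    · exact le_rfl
  have hY0 : 0 ≤ ∑ i, y i ^ 2 := sum_nonneg fun i _ => sq_nonneg _
  rw [e1]
  set X := ∑ i, x i ^ 2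
  set Y := ∑ i, y i ^ 2
  set D := √(a + b) with hD
  have hD0 : 0 < D := Real.sqrt_pos.mpr hd
  have hDD : a + b = D ^ 2 := (Real.sq_sqrt hd.le).symm
  have hD1 : 1 ≤ D := Real.one_le_sqrt.mpr (by linarith)
  have han : a / n ≤ 1 := div_le_one_of_le₀ hn hn'.le
  have d1 : a / n * Y ≤ D * X := by
    apply mul_le_mul (han.trans hD1) hX hY0 hD0.le
  have d10 : 0 ≤ a / n * Y := mul_nonneg (div_nonneg (by linarith) hn'.le) hY0
  have d2 : 7300 * D * Y ≤ 7300 * D * X := by gcongr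
  have key : ∀ c p : ℝ, 0 ≤ c → c ≤ a + b → |p| ≤ 2 * (2 * n : ℕ) / D * X →
      |c / (2 * n) * p| ≤ 2 * D * X := by
    intro c p hc0 hc hp
    rw [abs_mul, abs_of_nonneg (by positivity)]
    calc _ ≤ (a + b) / (2 * n) * (2 * (2 * n : ℕ) / D * X) := by gcongr
      _ = 2 * D * X := by rw [hDD]; push_cast; field_simp
  have k1 := key (a + b) _ hd.le le_rfl c2
  have k2 := key (a - b) _ (by linarith) (by linarith) c3
  rw [abs_le] at c1 k1 k2 ⊢
  rw [mul_sub] at k1 k2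
  constructor <;> linarith

/-- On an invariant subspace all of whose eigenvalues are at most `m`, the quadratic form of a
symmetric operator is at most `m`. -/
lemma inner_apply_le_of_eigenvalues_le {E : Type*} [NormedAddCommGroup E] [InnerProductSpace ℝ E]
    [FiniteDimensional ℝ E] {T : E →ₗ[ℝ] E} (hT : T.IsSymmetric) {U : Submodule ℝ E}
    (hU : ∀ x ∈ U, T x ∈ U) {m : ℝ}
    (h : ∀ (μ : ℝ) (v : E), v ≠ 0 → v ∈ U → T v = μ • v → μ ≤ m) {x : E} (hx : x ∈ U) :
    inner ℝ x (T x) ≤ m * ‖x‖ ^ 2 := by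
  have hS := hT.restrict_invariant hU
  set S := T.restrict hU
  set e := hS.eigenvectorBasis rfl
  set x' : U := ⟨x, hx⟩
  have h1 : inner ℝ x (T x) = inner ℝ x' (S x') := rfl
  have h2 : ‖x‖ = ‖x'‖ := rfl
  rw [h1, h2, ← e.sum_inner_mul_inner, ← e.sum_sq_inner_right, mul_sum]
  refine sum_le_sum fun i _ => ?_
  have h3 : S (e i) = hS.eigenvalues rfl i • e i := hS.apply_eigenvectorBasis rfl i
  have h4 : hS.eigenvalues rfl i ≤ m := by
    refine h _ (e i : E) ?_ (e i).2 (congrArg Subtype.val h3)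
    simpa using e.toBasis.ne_zero i
  rw [← hS (e i) x', h3, inner_smul_left, real_inner_comm]
  simp only [conj_trivial]
  nlinarith [sq_nonneg (inner ℝ (e i) x')]

/-- If a symmetric operator is within `ε` of a rank-two form with orthonormal axes `e`, `f`, then
a unit vector orthogonal to `e` in its top invariant plane is nearly parallel to `f`. -/
lemma inner_sq_ge_of_top_two {E : Type*} [NormedAddCommGroup E] [InnerProductSpace ℝ E]
    [FiniteDimensional ℝ E] {T : E →ₗ[ℝ] E} (hT : T.IsSymmetric) {e f : E} (he : ‖e‖ = 1)
    (hf : ‖f‖ = 1) (hef : inner ℝ e f = 0) {α β ε : ℝ} (hβα : β ≤ α)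
    (hq : ∀ x, |inner ℝ x (T x) - (α * inner ℝ e x ^ 2 + β * inner ℝ f x ^ 2)| ≤ ε * ‖x‖ ^ 2)
    {u₁ u₂ : E} {μ₁ μ₂ : ℝ} (hu : inner ℝ u₁ u₂ = 0) (hu₁ : ‖u₁‖ = 1) (hu₂ : ‖u₂‖ = 1)
    (h₁ : T u₁ = μ₁ • u₁) (h₂ : T u₂ = μ₂ • u₂)
    (htop : ∀ (μ : ℝ) (v : E), v ≠ 0 → v ∈ (Submodule.span ℝ {u₁, u₂})ᗮ → T v = μ • v →
      μ ≤ min μ₁ μ₂)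
    {v : E} (hv : v ∈ Submodule.span ℝ {u₁, u₂}) (hv1 : ‖v‖ = 1) (hev : inner ℝ e v = 0) :
    β * (1 - inner ℝ f v ^ 2) ≤ 2 * ε := by
  wlog hμ : μ₂ ≤ μ₁ generalizing u₁ u₂ μ₁ μ₂
  · refine this (u₁ := u₂) (u₂ := u₁) (by rwa [real_inner_comm]) hu₂ hu₁ h₂ h₁ ?_ ?_ (by linarith)
    · rwa [Set.pair_comm, min_comm]
    · rwa [Set.pair_comm]
  rw [min_eq_right hμ] at htop
  have memperp : ∀ x, x ∈ (Submodule.span ℝ {u₁, u₂})ᗮ ↔ inner ℝ u₁ x = 0 ∧ inner ℝ u₂ x = 0 := by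
    intro x
    rw [Submodule.mem_orthogonal]
    constructor
    · intro h
      exact ⟨h _ (Submodule.subset_span (by simp)), h _ (Submodule.subset_span (by simp))⟩
    · rintro ⟨h1, h2⟩ u hu
      obtain ⟨p, q, rfl⟩ := Submodule.mem_span_pair.mp hu
      simp [inner_add_left, inner_smul_left, h1, h2]
  have hinv : ∀ x ∈ (Submodule.span ℝ {u₁, u₂})ᗮ, T x ∈ (Submodule.span ℝ {u₁, u₂})ᗮ := by
    intro x hx
    rw [memperp] at hx ⊢
    rw [← hT, ← hT, h₁, h₂, inner_smul_left, inner_smul_left, hx.1, hx.2]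
    simp
  have hperp : ∀ x ∈ (Submodule.span ℝ {u₁, u₂})ᗮ, inner ℝ x (T x) ≤ μ₂ * ‖x‖ ^ 2 :=
    fun x hx => inner_apply_le_of_eigenvalues_le hT hinv htop hx
  have hu22 : inner ℝ u₂ u₂ = (1 : ℝ) := by rw [real_inner_self_eq_norm_sq, hu₂]; norm_num
  have hu11 : inner ℝ u₁ u₁ = (1 : ℝ) := by rw [real_inner_self_eq_norm_sq, hu₁]; norm_num
  have hee : inner ℝ e e = (1 : ℝ) := by rw [real_inner_self_eq_norm_sq, he]; norm_num
  have hff : inner ℝ f f = (1 : ℝ) := by rw [real_inner_self_eq_norm_sq, hf]; norm_num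
  have hfe : inner ℝ f e = (0 : ℝ) := by rw [real_inner_comm]; exact hef
  have hu21 : inner ℝ u₂ u₁ = (0 : ℝ) := by rw [real_inner_comm]; exact hu
  have hz : ∀ z, inner ℝ u₁ z = (0 : ℝ) → inner ℝ z (T z) ≤ μ₂ * ‖z‖ ^ 2 := by
    intro z hz
    set c := (inner ℝ u₂ z : ℝ) with hc
    set r := z - c • u₂ with hr
    have hr1 : inner ℝ u₁ r = (0 : ℝ) := by
      rw [hr, inner_sub_right, inner_smul_right, hz, hu]; simp
    have hr2 : inner ℝ u₂ r = (0 : ℝ) := by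
      rw [hr, inner_sub_right, inner_smul_right, hu22, hc]; simp
    have hr2' : inner ℝ r u₂ = (0 : ℝ) := by rw [real_inner_comm]; exact hr2
    have h3 := hperp r ((memperp r).mpr ⟨hr1, hr2⟩)
    have h4 : inner ℝ u₂ (T r) = (0 : ℝ) := by rw [← hT, h₂, inner_smul_left, hr2]; simp
    have hzr : z = r + c • u₂ := by rw [hr]; abel
    rw [← real_inner_self_eq_norm_sq] at h3 ⊢
    rw [hzr]
    simp only [map_add, map_smul, inner_add_left, inner_add_right, inner_smul_left,
      inner_smul_right, h₂, h4, hr2, hr2', hu22, conj_trivial]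
    linarith
  have hm : β - ε ≤ μ₂ := by
    obtain ⟨s, t, hst, hpos⟩ : ∃ s t : ℝ, inner ℝ u₁ (s • e + t • f) = (0 : ℝ) ∧
        0 < s ^ 2 + t ^ 2 := by
      by_cases h : inner ℝ u₁ e = (0 : ℝ)
      · exact ⟨1, 0, by simp [h], by norm_num⟩
      · refine ⟨inner ℝ u₁ f, -inner ℝ u₁ e, ?_, add_pos_of_nonneg_of_pos (sq_nonneg _)
          ((sq_nonneg _).lt_of_ne' (pow_ne_zero 2 (neg_ne_zero.mpr h)))⟩
        simp only [inner_add_right, inner_smul_right]; ring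
    have h3 := hz _ hst
    have h4 := (abs_le.mp (hq (s • e + t • f))).1
    have h5 : ‖s • e + t • f‖ ^ 2 = s ^ 2 + t ^ 2 := by
      rw [← real_inner_self_eq_norm_sq]
      simp only [inner_add_left, inner_add_right, inner_smul_left, inner_smul_right, hee, hff, hef,
        hfe, conj_trivial]
      ring
    rw [h5] at h3 h4
    simp only [inner_add_right _ (s • e), inner_smul_right, hee, hff, hef, hfe] at h4
    have h6 : (β - ε) * (s ^ 2 + t ^ 2) ≤ μ₂ * (s ^ 2 + t ^ 2) := by
      nlinarith [mul_nonneg (sub_nonneg.mpr hβα) (sq_nonneg s)]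
    exact le_of_mul_le_mul_right h6 hpos
  have hvT : μ₂ ≤ inner ℝ v (T v) := by
    obtain ⟨p, q, rfl⟩ := Submodule.mem_span_pair.mp hv
    have h3 : p ^ 2 + q ^ 2 = 1 := by
      have : ‖p • u₁ + q • u₂‖ ^ 2 = 1 := by rw [hv1]; norm_num
      rw [← this, ← real_inner_self_eq_norm_sq]
      simp only [inner_add_left, inner_add_right, inner_smul_left, inner_smul_right, hu11, hu22, hu,
        hu21, conj_trivial]
      ring
    simp only [map_add, map_smul, inner_add_left, inner_add_right, inner_smul_left,
      inner_smul_right, h₁, h₂, hu11, hu22, hu, hu21, conj_trivial]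
    have h4 : μ₂ * (p ^ 2 + q ^ 2) = μ₂ := by rw [h3, mul_one]
    nlinarith [mul_nonneg (sub_nonneg.mpr hμ) (sq_nonneg p)]
  have h7 := (abs_le.mp (hq v)).2
  rw [hv1, hev] at h7
  linarith

lemma correct2_of_sum_sq_le {n : ℕ} {γ : ℝ} {y : Fin (2 * n) → ℝ}
    (hy : ∑ i, (y i - blockSign n i) ^ 2 ≤ 2 * (γ * n))
    {P : Finset (Fin (2 * n)) × Finset (Fin (2 * n))} (hc : P.1.card = n) (hP : P.2 = P.1ᶜ)
    (hs : ∀ i ∈ P.1, ∀ j ∈ P.2, y j ≤ y i) : correct2 n γ P := by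
  have h1 : (block1 n ∩ P.1).card + (block1 n ∩ P.2).card = n := by
    rw [hP, ← sdiff_eq_inter_compl, card_inter_add_card_sdiff, card_block1]
  have h2 : (block1 n ∩ P.1).card + (block2 n ∩ P.1).card = n := by
    rw [inter_comm, inter_comm (block2 n), block2_eq_compl, ← sdiff_eq_inter_compl,
      card_inter_add_card_sdiff, hc]
  have h3 : (block2 n ∩ P.1).card + (block2 n ∩ P.2).card = n := by
    rw [hP, ← sdiff_eq_inter_compl, card_inter_add_card_sdiff, block2_eq_compl, card_compl,
      card_block1, Fintype.card_fin]; omega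
  set A := block1 n ∩ P.2 with hA
  set B := block2 n ∩ P.1 with hB
  have hAB : A.card = B.card := by omega
  have hdisj : Disjoint A B := by
    rw [hA, hB, block2_eq_compl]
    exact disjoint_compl_right.mono inter_subset_left inter_subset_left
  have hpair : 2 * (A.card : ℝ) ≤ ∑ i ∈ A, (y i - 1) ^ 2 + ∑ i ∈ B, (y i + 1) ^ 2 := by
    let σ := equivOfCardEq hAB
    rw [← sum_coe_sort A, ← sum_coe_sort B, ← σ.sum_comp, ← sum_add_distrib]
    calc 2 * (A.card : ℝ) = ∑ _i : A, (2 : ℝ) := by simp [mul_comm]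
      _ ≤ _ := sum_le_sum fun i _ => by
        have := hs _ (mem_inter.mp (σ i).2).2 _ (mem_inter.mp i.2).2
        nlinarith [sq_nonneg (y i - 1 + (y (σ i) + 1))]
  have hle : ∑ i ∈ A, (y i - 1) ^ 2 + ∑ i ∈ B, (y i + 1) ^ 2 ≤ ∑ i, (y i - blockSign n i) ^ 2 := by
    have e1 : ∑ i ∈ A, (y i - 1) ^ 2 = ∑ i ∈ A, (y i - blockSign n i) ^ 2 :=
      sum_congr rfl fun i hi => by
        have : (i : ℕ) < n := by simpa [block1] using (mem_inter.mp hi).1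
        simp [blockSign, this]
    have e2 : ∑ i ∈ B, (y i + 1) ^ 2 = ∑ i ∈ B, (y i - blockSign n i) ^ 2 :=
      sum_congr rfl fun i hi => by
        have : ¬ (i : ℕ) < n := by simpa [block2] using (mem_inter.mp hi).1
        simp [blockSign, this]
    rw [e1, e2, ← sum_union hdisj]
    exact sum_le_sum_of_subset_of_nonneg (subset_univ _) fun i _ _ => sq_nonneg _
  have hm : (A.card : ℝ) ≤ γ * n := by linarith
  have h1' : ((block1 n ∩ P.1).card : ℝ) + A.card = n := by exact_mod_cast h1
  have h3' : (B.card : ℝ) + (block2 n ∩ P.2).card = n := by exact_mod_cast h3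
  have hAB' : (A.card : ℝ) = B.card := by exact_mod_cast hAB
  constructor <;> linarith

lemma correct2_or_swap_s4 {n : ℕ} {γ : ℝ} {v : Fin (2 * n) → ℝ}
    (hv : ∑ i, v i ^ 2 = 1)
    (hvs : 2 * n * (1 - γ / 2) ≤ (∑ i, blockSign n i * v i) ^ 2)
    {P : Finset (Fin (2 * n)) × Finset (Fin (2 * n))} (hc : P.1.card = n) (hP : P.2 = P.1ᶜ)
    (hs : ∀ i ∈ P.1, ∀ j ∈ P.2, v j ≤ v i) : correct2 n γ P ∨ correct2 n γ P.swap := by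
  have main : ∀ (w : Fin (2 * n) → ℝ) (Q : Finset (Fin (2 * n)) × Finset (Fin (2 * n))),
      ∑ i, w i ^ 2 = 1 → 2 * n * (1 - γ / 2) ≤ (∑ i, blockSign n i * w i) ^ 2 →
      0 ≤ ∑ i, blockSign n i * w i → Q.1.card = n → Q.2 = Q.1ᶜ →
      (∀ i ∈ Q.1, ∀ j ∈ Q.2, w j ≤ w i) → correct2 n γ Q := by
    intro w Q hw hws hw0 hQc hQ hQs
    set c := ∑ i, blockSign n i * w i with hcdef
    set r := √(2 * n : ℝ) with hr
    have hr2 : r ^ 2 = 2 * n := Real.sq_sqrt (by positivity)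
    have hr0 : 0 ≤ r := Real.sqrt_nonneg _
    have hsq : ∑ i, blockSign n i ^ 2 = 2 * n := by simp [blockSign_sq]
    have hcs : c ^ 2 ≤ r ^ 2 := by
      have := sum_mul_sq_le_sq_mul_sq univ (blockSign n) w
      rwa [hsq, hw, mul_one, ← hr2] at this
    have hcr : c ≤ r := abs_le_of_sq_le_sq' hcs hr0 |>.2
    refine correct2_of_sum_sq_le (y := fun i => r * w i) ?_ hQc hQ
      fun i hi j hj => mul_le_mul_of_nonneg_left (hQs i hi j hj) hr0
    have e : ∑ i, (r * w i - blockSign n i) ^ 2 = r ^ 2 * 1 - 2 * (r * c) + 2 * n := by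
      rw [← hw, ← hsq, hcdef, mul_sum, mul_sum, mul_sum, ← sum_sub_distrib, ← sum_add_distrib]
      exact sum_congr rfl fun i _ => by ring
    rw [e]
    nlinarith
  rcases le_total 0 (∑ i, blockSign n i * v i) with h | h
  · exact Or.inl (main v P hv hvs h hc hP hs)
  · refine Or.inr (main (fun i => -v i) P.swap (by simpa using hv) (by simpa using hvs)
      (by simpa using h) ?_ ?_ ?_)
    · simp only [Prod.fst_swap, hP, card_compl, hc, Fintype.card_fin]; omega
    · simp [hP]
    · intro i hi j hj
      exact neg_le_neg (hs j hj i hi)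

lemma zeroOutHighDeg_adjMat_symm {N : ℕ} (d : ℝ) (ω : Config N) (i j : Fin N) :
    zeroOutHighDeg d ω (adjMat ω) i j = zeroOutHighDeg d ω (adjMat ω) j i := by
  unfold zeroOutHighDeg
  rw [adjMat_symm ω i j]
  simp only [or_comm]

lemma inner_toEuclideanLin {N : ℕ} (M : Matrix (Fin N) (Fin N) ℝ)
    (x : EuclideanSpace ℝ (Fin N)) :
    inner ℝ x (Matrix.toEuclideanLin M x) = ∑ i, ∑ j, M i j * (x i * x j) := by
  rw [PiLp.inner_apply]
  refine sum_congr rfl fun i _ => ?_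
  simp only [Matrix.toLpLin_apply, Matrix.mulVec, dotProduct, RCLike.inner_apply, conj_trivial]
  rw [sum_mul]
  exact sum_congr rfl fun j _ => by ring

lemma inner_vbar1 {n : ℕ} (x : EuclideanSpace ℝ (Fin (2 * n))) :
    inner ℝ (vbar1 n) x = (∑ i, x i) / √(2 * n) := by
  rw [PiLp.inner_apply, sum_div]
  refine sum_congr rfl fun i _ => ?_
  simp [vbar1, mkVec, div_eq_mul_inv]

lemma vbar2_apply (n : ℕ) (i : Fin (2 * n)) : vbar2 n i = blockSign n i / √(2 * n) := by
  simp only [vbar2, mkVec, blockSign, PiLp.continuousLinearEquiv_symm_apply]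
  split_ifs <;> simp [neg_div]

lemma inner_vbar2 {n : ℕ} (x : EuclideanSpace ℝ (Fin (2 * n))) :
    inner ℝ (vbar2 n) x = (∑ i, blockSign n i * x i) / √(2 * n) := by
  rw [PiLp.inner_apply, sum_div]
  refine sum_congr rfl fun i _ => ?_
  simp only [vbar2_apply, RCLike.inner_apply, conj_trivial]
  ring

lemma sum_blockSign (n : ℕ) : ∑ i, blockSign n i = 0 := by
  unfold blockSign
  rw [sum_ite, sum_const, sum_const]
  have h1 := card_block1 n
  have h2 : (block2 n).card = n := by
    rw [block2_eq_compl, card_compl, h1, Fintype.card_fin]; omega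
  unfold block1 at h1
  unfold block2 at h2
  rw [h1, h2]; simp

lemma norm_vbar1 {n : ℕ} (hn : 0 < n) : ‖vbar1 n‖ = 1 := by
  have hn' : (0 : ℝ) < n := by exact_mod_cast hn
  have h : ‖vbar1 n‖ ^ 2 = 1 := by
    rw [EuclideanSpace.real_norm_sq_eq]
    simp [vbar1, mkVec]
    field_simp
    rw [Real.sq_sqrt (by positivity), Real.sq_sqrt (by positivity)]
    ring
  exact (pow_eq_one_iff_of_nonneg (norm_nonneg _) two_ne_zero).mp h

lemma norm_vbar2 {n : ℕ} (hn : 0 < n) : ‖vbar2 n‖ = 1 := by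
  have hn' : (0 : ℝ) < n := by exact_mod_cast hn
  have h : ‖vbar2 n‖ ^ 2 = 1 := by
    rw [EuclideanSpace.real_norm_sq_eq]
    simp only [vbar2_apply, div_pow, blockSign_sq]
    simp
    field_simp
    rw [Real.sq_sqrt (by positivity), Real.sq_sqrt (by positivity)]
  exact (pow_eq_one_iff_of_nonneg (norm_nonneg _) two_ne_zero).mp h

lemma inner_vbar1_vbar2 (n : ℕ) : inner ℝ (vbar1 n) (vbar2 n) = (0 : ℝ) := by
  rw [inner_vbar1]
  simp only [vbar2_apply, ← sum_div, sum_blockSign, zero_div]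

/-- Deterministic correctness of Spectral Partition on configurations satisfying the two
concentration properties. -/
lemma IsSpectralOutput.correct2 {n : ℕ} {a b γ : ℝ} (hb : 1 ≤ b) (hba : b < a) (hn : a ≤ n)
    (hγ : 29220 * √(a + b) ≤ γ * (a - b)) {ω : Config (2 * n)} (hL : LightBound n a b ω)
    (hE : EdgeDiscrepancy n (a + b) ω) {P : Finset (Fin (2 * n)) × Finset (Fin (2 * n))}
    (hP : IsSpectralOutput n ω (a + b) P) :
    correct2 n γ P ∨ correct2 n γ P.swap := by
  have hn' : (0 : ℝ) < n := by linarith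
  have hn0 : 0 < n := by exact_mod_cast hn'
  obtain ⟨W, v, ⟨u₁, u₂, μ₁, μ₂, hu, hu₁, hu₂, rfl, h₁, h₂, htop⟩, hv, hv1, horth, hc, hP2, hs⟩ := hP
  set A := zeroOutHighDeg (a + b) ω (adjMat ω) with hA
  have hT : (Matrix.toEuclideanLin A).IsSymmetric := by
    refine Matrix.isSymmetric_toEuclideanLin_iff.mpr ?_
    ext i j
    simp [hA, zeroOutHighDeg_adjMat_symm (a + b) ω j i]
  have hsq : √(2 * n : ℝ) ^ 2 = 2 * n := Real.sq_sqrt (by positivity)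
  have hev : inner ℝ (vbar1 n) v = (0 : ℝ) := by
    have h3 : inner ℝ (mkVec fun _ : Fin (2 * n) => (1 : ℝ)) v = (0 : ℝ) := by
      rw [← horth, projCLM, real_inner_comm, real_inner_comm v]
      exact (Submodule.inner_orthogonalProjectionOnto_eq_of_mem_left ⟨v, hv⟩ _).symm
    rw [inner_vbar1]
    rw [PiLp.inner_apply] at h3
    simp [mkVec] at h3
    rw [h3, zero_div]
  have hq : ∀ x, |inner ℝ x (Matrix.toEuclideanLin A x) -
      ((a + b) * inner ℝ (vbar1 n) x ^ 2 + (a - b) * inner ℝ (vbar2 n) x ^ 2)|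
      ≤ 7305 * √(a + b) * ‖x‖ ^ 2 := by
    intro x
    have h4 := abs_zeroOut_sub_le hb hba.le hn hL hE x
    rw [inner_toEuclideanLin, inner_vbar1, inner_vbar2, EuclideanSpace.real_norm_sq_eq, div_pow,
      div_pow, hsq]
    convert h4 using 4 <;> ring
  have h5 := inner_sq_ge_of_top_two hT (norm_vbar1 hn0) (norm_vbar2 hn0) (inner_vbar1_vbar2 n)
    (by linarith) hq hu hu₁ hu₂ h₁ h₂ htop hv hv1 hev
  rw [inner_vbar2, div_pow, hsq] at h5
  refine correct2_or_swap_s4 (v := v) ?_ ?_ hc hP2 hs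
  · rw [← EuclideanSpace.real_norm_sq_eq, hv1]; norm_num
  · have h6 : (a - b) * (1 - (∑ i, blockSign n i * v i) ^ 2 / (2 * n)) ≤ (a - b) * (γ / 2) := by
      linarith
    have h7 := le_of_mul_le_mul_left h6 (by linarith)
    have h8 : 1 - γ / 2 ≤ (∑ i, blockSign n i * v i) ^ 2 / (2 * n) := by linarith
    rw [le_div_iff₀ (by positivity)] at h8
    linarith

lemma one_sub_le_sbm2_correct {n : ℕ} {a b γ : ℝ} (hb : 1 ≤ b) (hba : b < a) (hn : a ≤ n)
    (hγ : 29220 * √(a + b) ≤ γ * (a - b)) :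
    1 - (ENNReal.ofReal (Real.exp (-(2 * n))) + ENNReal.ofReal (1 / n)) ≤
      sbm2 n a b {ω | ∀ P, IsSpectralOutput n ω (a + b) P →
        correct2 n γ P ∨ correct2 n γ P.swap} := by
  rw [tsub_le_iff_right]
  have h1 := sbm2_exists_lightProd_tail (n := n) (by linarith) hba.le hn
  have h2 := sbm2_not_edgeDiscrepancy (n := n) (by linarith) hba.le hn
  rw [← measure_univ (μ := sbm2 n a b)]
  refine le_trans ?_ (add_le_add le_rfl (add_le_add h1 h2))
  refine le_trans (measure_mono ?_) ((measure_union_le _ _).trans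
    (add_le_add le_rfl (measure_union_le _ _)))
  intro ω _
  by_cases hL : LightBound n a b ω
  · by_cases hE : EdgeDiscrepancy n (a + b) ω
    · exact Or.inl fun P hP => hP.correct2 hb hba hn hγ hL hE
    · exact Or.inr (Or.inr hE)
  · refine Or.inr (Or.inl ?_)
    simp only [LightBound, not_forall, not_le] at hL
    obtain ⟨z, hz, w, hw, h⟩ := hL
    exact ⟨z, hz, w, hw, h⟩

/-- Theorem 2.2 / `thm:main`: there are absolute constants `C₀, C₁`
such that whenever `a > b > C₀`, `γ > 0` and `(a-b)²/(a+b) ≥ C₁/γ²`, with probability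
`1 - o(1)` every output of the **Spectral Partition** procedure on a graph drawn from
`SBM(n,a,b)` is a `γ`-correct partition (up to the labelling of the two blocks). -/
theorem spectral_partition_gamma_correct :
    ∃ C₀ C₁ : ℝ, ∀ a b γ : ℝ, C₀ < b → b < a → 0 < γ →
      C₁ * (1 / γ ^ 2) ≤ (a - b) ^ 2 / (a + b) →
      Tendsto
        (fun n => sbm2 n a b
          {ω | ∀ P, IsSpectralOutput n ω (a + b) P →
            correct2 n γ P ∨ correct2 n γ P.swap})
        atTop (nhds 1) := by
  refine ⟨1, 29220 ^ 2, fun a b γ hb hba hγ h => ?_⟩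
  have hd : 0 < a + b := by linarith
  have hγ' : 29220 * √(a + b) ≤ γ * (a - b) := by
    refine (abs_le_of_sq_le_sq' ?_ (mul_nonneg hγ.le (by linarith))).2
    rw [mul_one_div, div_le_div_iff₀ (by positivity) hd] at h
    rw [mul_pow, Real.sq_sqrt hd.le]
    linarith
  have hlim : Tendsto (fun n : ℕ => 1 - (ENNReal.ofReal (Real.exp (-(2 * n))) +
      ENNReal.ofReal (1 / n))) atTop (nhds 1) := by
    have e1 : Tendsto (fun n : ℕ => Real.exp (-(2 * (n : ℝ)))) atTop (nhds 0) :=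
      Real.tendsto_exp_neg_atTop_nhds_zero.comp
        (tendsto_natCast_atTop_atTop.const_mul_atTop two_pos)
    have e2 := ENNReal.tendsto_ofReal e1
    have e3 := ENNReal.tendsto_ofReal (tendsto_one_div_atTop_nhds_zero_nat (𝕜 := ℝ))
    have e4 := ENNReal.Tendsto.sub (tendsto_const_nhds (x := (1 : ENNReal))) (e2.add e3)
      (Or.inl ENNReal.one_ne_top)
    simpa using e4
  refine tendsto_of_tendsto_of_tendsto_of_le_of_le' hlim tendsto_const_nhds ?_
    (Eventually.of_forall fun n => prob_le_one)
  filter_upwards [tendsto_natCast_atTop_atTop.eventually_ge_atTop a] with n hn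
  exact one_sub_le_sbm2_correct hb.le hba hn hγ'
end
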